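/- Let p : ℕ → (0,1] satisfy n·p(n) → ∞, let C > 0, and let (G_n) be a sequence of graphs with |G_n| = n such that sup_n s_p(T,G_n) < ∞ for every finite tree T. Suppose δ_□(G_n,κ) → 0 for some kernel κ : [0,1]² → [0,C]. Then for each finite tree T, s_p(T,G_n) → s(T,κ) as n → ∞. -/

import Mathlib

open MeasureTheory Set Filter
open scoped ENNReal Classical

noncomputable section

/-- The (0-based) index of the subinterval `((i)/n, (i+1)/n]` of `[0,1]` containing `x`. -/
def idx (n : ℕ) (x : ℝ) : ℕ := ⌈x * n⌉₊ - 1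

/-- The subset of `[0,1]` corresponding to a set of vertices of a graph on `Fin n`:
the union of the intervals `(i/n, (i+1)/n]` for `i ∈ X` (vertices `0`-indexed). -/
def vtxSet (n : ℕ) (X : Finset (Fin n)) : Set ℝ :=
  ⋃ i ∈ X, Ioc ((i : ℝ) / n) (((i : ℝ) + 1) / n)

/-- The kernel associated to a graph `G` on `{1,…,n}` and normalizing constant `p`:
it takes the value `1/p` on `((i−1)/n, i/n] × ((j−1)/n, j/n]` whenever `ij ∈ E(G)`,
and `0` elsewhere. -/
def graphKernel {n : ℕ} (p : ℝ) (G : SimpleGraph (Fin n)) : ℝ → ℝ → ℝ := fun x y =>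
  if h : x ∈ Ioc (0:ℝ) 1 ∧ y ∈ Ioc (0:ℝ) 1 ∧ idx n x < n ∧ idx n y < n then
    (if G.Adj ⟨idx n x, h.2.2.1⟩ ⟨idx n y, h.2.2.2⟩ then 1 / p else 0)
  else 0

/-- The cut norm of `W : [0,1]² → ℝ`. -/
def cutNorm (W : ℝ → ℝ → ℝ) : ℝ :=
  sSup {r | ∃ S T : Set ℝ, MeasurableSet S ∧ MeasurableSet T ∧
    S ⊆ Icc 0 1 ∧ T ⊆ Icc 0 1 ∧ r = |∫ q in S ×ˢ T, W q.1 q.2|}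

/-- `τ` is a Lebesgue-measure-preserving bijection of `[0,1]`. -/
def MPBij (τ : ℝ → ℝ) : Prop :=
  MeasurePreserving τ (volume.restrict (Icc 0 1)) (volume.restrict (Icc 0 1)) ∧
    BijOn τ (Icc 0 1) (Icc 0 1)

/-- The cut distance between two kernels. -/
def cutDist (κ₁ κ₂ : ℝ → ℝ → ℝ) : ℝ :=
  sInf {r | ∃ τ : ℝ → ℝ, MPBij τ ∧ r = cutNorm (fun x y => κ₁ x y - κ₂ (τ x) (τ y))}

/-- The number of homomorphisms from `F` to `G`. -/
def homCount {α β : Type*} (F : SimpleGraph α) (G : SimpleGraph β) : ℕ :=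
  Nat.card (F →g G)

/-- The number of injective homomorphisms (embeddings) from `F` to `G`. -/
def embCount {α β : Type*} (F : SimpleGraph α) (G : SimpleGraph β) : ℕ :=
  Nat.card {φ : F →g G // Function.Injective φ}

/-- The number of edges of a graph. -/
def edgeCount {α : Type*} (F : SimpleGraph α) : ℕ := Nat.card F.edgeSet

/-- The normalized homomorphism count `t_p(F,G)`. -/
def tDen {α β : Type*} [Fintype α] [Fintype β] (p : ℝ) (F : SimpleGraph α)
    (G : SimpleGraph β) : ℝ :=
  homCount F G / (p ^ edgeCount F * (Fintype.card β : ℝ) ^ Fintype.card α)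

/-- The normalized embedding count `s_p(F,G)`. -/
def sDen {α β : Type*} [Fintype α] [Fintype β] (p : ℝ) (F : SimpleGraph α)
    (G : SimpleGraph β) : ℝ :=
  embCount F G / (p ^ edgeCount F * ((Fintype.card β).descFactorial (Fintype.card α) : ℝ))

/-- The homomorphism density `s(F,κ)` of a finite graph in a kernel. -/
def homDensity {α : Type*} [Fintype α] (F : SimpleGraph α) (κ : ℝ → ℝ → ℝ) : ℝ :=
  ∫ x in Set.univ.pi (fun _ : α => Icc (0:ℝ) 1),
    ∏ e ∈ F.edgeFinset,
      Sym2.lift ⟨fun i j => (κ (x i) (x j) + κ (x j) (x i)) / 2,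
        fun i j => by dsimp only; rw [add_comm (κ (x i) (x j)) (κ (x j) (x i))]⟩ e

/-- The homomorphism density as a lower integral (for possibly unbounded kernels). -/
def homDensityL {α : Type*} [Fintype α] (F : SimpleGraph α) (κ : ℝ → ℝ → ℝ) : ℝ≥0∞ :=
  ∫⁻ x in Set.univ.pi (fun _ : α => Icc (0:ℝ) 1),
    ∏ e ∈ F.edgeFinset,
      Sym2.lift ⟨fun i j => ENNReal.ofReal ((κ (x i) (x j) + κ (x j) (x i)) / 2),
        fun i j => by dsimp only; rw [add_comm (κ (x i) (x j)) (κ (x j) (x i))]⟩ e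

/-- A kernel: a symmetric measurable function `[0,1]² → [0,∞)`. -/
def IsKernel (κ : ℝ → ℝ → ℝ) : Prop :=
  Measurable (Function.uncurry κ) ∧ (∀ x y, κ x y = κ y x) ∧ ∀ x y, 0 ≤ κ x y

/-- A kernel taking values in `[0,C]`. -/
def IsKernelBdd (κ : ℝ → ℝ → ℝ) (C : ℝ) : Prop :=
  Measurable (Function.uncurry κ) ∧ (∀ x y, κ x y = κ y x) ∧ ∀ x y, κ x y ∈ Icc 0 C

/-- A standard kernel: a symmetric measurable function `[0,1]² → [0,1]`. -/
def IsStdKernel (κ : ℝ → ℝ → ℝ) : Prop := IsKernelBdd κ 1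

/-- A doubly stochastic measure: a Borel measure on `[0,1]²` both of whose marginals
are Lebesgue measure on `[0,1]`. -/
def IsDoublyStochastic (μ : Measure (ℝ × ℝ)) : Prop :=
  μ.map Prod.fst = volume.restrict (Icc 0 1) ∧ μ.map Prod.snd = volume.restrict (Icc 0 1)

/-- The quantity `d_μ(κ₁,κ₂)`. -/
def dMu (μ : Measure (ℝ × ℝ)) (κ₁ κ₂ : ℝ → ℝ → ℝ) : ℝ :=
  sSup {r | ∃ S T : Set (ℝ × ℝ), MeasurableSet S ∧ MeasurableSet T ∧
    S ⊆ Icc 0 1 ×ˢ Icc 0 1 ∧ T ⊆ Icc 0 1 ×ˢ Icc 0 1 ∧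
    r = |∫ w in S ×ˢ T, (κ₁ w.1.1 w.2.1 - κ₂ w.1.2 w.2.2) ∂(μ.prod μ)|}

/-- Equivalence of kernels via a coupling. -/
def KernelEquiv (κ₁ κ₂ : ℝ → ℝ → ℝ) : Prop :=
  ∃ μ : Measure (ℝ × ℝ), IsDoublyStochastic μ ∧
    ∀ᵐ w ∂(μ.prod μ), κ₁ w.1.1 w.2.1 = κ₂ w.1.2 w.2.2

/-- `e_G(A,B)`: the number of ordered pairs `(i,j) ∈ A × B` with `ij ∈ E(G)`. -/
def ePairs {n : ℕ} (G : SimpleGraph (Fin n)) (A B : Finset (Fin n)) : ℕ :=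
  ((A ×ˢ B).filter fun q => G.Adj q.1 q.2).card

/-- The normalized density `d_p(A,B)`. -/
def dDens {n : ℕ} (p : ℝ) (G : SimpleGraph (Fin n)) (A B : Finset (Fin n)) : ℝ :=
  ePairs G A B / (p * A.card * B.card)

/-- A sequence of graphs has density bounded by `C`. -/
def DensityBoundedBy (p : ℕ → ℝ) (G : ∀ n, SimpleGraph (Fin n)) (C : ℝ) : Prop :=
  ∀ ε > (0:ℝ), ∀ δ > (0:ℝ), ∀ᶠ n in atTop, ∀ A B : Finset (Fin n),
    ε * n ≤ A.card → ε * n ≤ B.card → dDens (p n) (G n) A B ≤ C + δ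

/-- The parts of a partition of `Fin n` indexed by `Fin k`, given as a colouring. -/
def fiber {n k : ℕ} (c : Fin n → Fin k) (a : Fin k) : Finset (Fin n) :=
  Finset.univ.filter fun v => c v = a

/-- The finite-type kernel `G/Π` associated to a partition of the vertex set of `G`. -/
def partKernel {n k : ℕ} (p : ℝ) (G : SimpleGraph (Fin n)) (c : Fin n → Fin k) :
    ℝ → ℝ → ℝ := fun x y =>
  if h : x ∈ Ioc (0:ℝ) 1 ∧ y ∈ Ioc (0:ℝ) 1 ∧ idx n x < n ∧ idx n y < n then
    dDens p G (fiber c (c ⟨idx n x, h.2.2.1⟩)) (fiber c (c ⟨idx n y, h.2.2.2⟩))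
  else 0

/-- A partition is weakly `(ε,p)`-regular for `G`. -/
def WeaklyRegular {n k : ℕ} (p ε : ℝ) (G : SimpleGraph (Fin n)) (c : Fin n → Fin k) : Prop :=
  cutNorm (fun x y => graphKernel p G x y - partKernel p G c x y) ≤ ε

/-- `(A,B)` is an `(ε,p)`-regular pair for `G`. -/
def RegPair {n : ℕ} (p ε : ℝ) (G : SimpleGraph (Fin n)) (A B : Finset (Fin n)) : Prop :=
  ∀ A' ⊆ A, ∀ B' ⊆ B, ε * A.card ≤ A'.card → ε * B.card ≤ B'.card →
    |dDens p G A' B' - dDens p G A B| ≤ ε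

/-- An `(ε,p)`-regular partition of `G` into `k` parts. -/
def RegPartition {n k : ℕ} (p ε : ℝ) (G : SimpleGraph (Fin n)) (c : Fin n → Fin k) : Prop :=
  (∀ a : Fin k, (fiber c a).card = n / k ∨ (fiber c a).card = n / k + 1) ∧
  ((Finset.univ.filter (fun q : Fin k × Fin k =>
      q.1 < q.2 ∧ ¬ RegPair p ε G (fiber c q.1) (fiber c q.2))).card : ℝ)
    ≤ ε * ((k : ℝ) * ((k : ℝ) - 1) / 2)

/-- The number of walks `v₀v₁⋯v_ℓ` in `G` with `v_i ∈ X_i` for each `i`. -/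
def walkCount {n ℓ : ℕ} (G : SimpleGraph (Fin n)) (X : Fin (ℓ+1) → Finset (Fin n)) : ℕ :=
  Nat.card {v : Fin (ℓ+1) → Fin n //
    (∀ i, v i ∈ X i) ∧ ∀ i : Fin ℓ, G.Adj (v i.castSucc) (v i.succ)}

/-- `κ(X₀,X₁,…,X_ℓ)`: the kernel analogue of the walk count. -/
def kernelWalk {ℓ : ℕ} (κ : ℝ → ℝ → ℝ) (X : Fin (ℓ+1) → Set ℝ) : ℝ :=
  ∫ x in Set.univ.pi X, ∏ i : Fin ℓ, κ (x i.castSucc) (x i.succ)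

/-- `p_t(u,v)`: the number of paths of length `t` in `G` from `u` to `v`. -/
def pathCount {n : ℕ} (G : SimpleGraph (Fin n)) (t : ℕ) (u v : Fin n) : ℕ :=
  Nat.card {w : Fin (t+1) → Fin n // w 0 = u ∧ w (Fin.last t) = v ∧
    Function.Injective w ∧ ∀ i : Fin t, G.Adj (w i.castSucc) (w i.succ)}

/-- The `i`-th vertex on the `r`-th subdivided edge (from `u r` to `v r`, `ℓ` steps). -/
def pv (ℓ : ℕ) {k m : ℕ} (u v : Fin m → Fin k) (r : Fin m) (i : ℕ) :
    Fin k ⊕ (Fin m × Fin (ℓ - 1)) :=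
  if h0 : i = 0 then Sum.inl (u r)
  else if h : i < ℓ then Sum.inr (r, ⟨i - 1, by omega⟩)
  else Sum.inl (v r)

/-- The `(ℓ−1)`-fold subdivision of the loopless multigraph with `k` vertices and
edges `u r — v r` for `r < m`. -/
def multiSubdiv (ℓ : ℕ) {k m : ℕ} (u v : Fin m → Fin k) :
    SimpleGraph (Fin k ⊕ (Fin m × Fin (ℓ - 1))) :=
  SimpleGraph.fromRel fun a b =>
    ∃ r : Fin m, ∃ i : ℕ, i < ℓ ∧ a = pv ℓ u v r i ∧ b = pv ℓ u v r (i + 1)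

/-- Membership in the family `F_ℓ` of `(ℓ−1)`-fold subdivisions of finite loopless
multigraphs. -/
def InFamilyF (ℓ : ℕ) {N : ℕ} (F : SimpleGraph (Fin N)) : Prop :=
  ∃ (k m : ℕ) (u v : Fin m → Fin k), 1 ≤ k ∧ (∀ r, u r ≠ v r) ∧
    Nonempty (F ≃g multiSubdiv ℓ u v)

/-- The edges of a simple graph on `Fin k`, as ordered pairs `(i,j)` with `i < j`. -/
abbrev edgeIdx {k : ℕ} (F : SimpleGraph (Fin k)) : Type :=
  {q : Fin k × Fin k // q.1 < q.2 ∧ F.Adj q.1 q.2}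

/-- The `i`-th vertex on the subdivision of the edge `e` (`t` steps). -/
def spv (t : ℕ) {k : ℕ} {F : SimpleGraph (Fin k)} (e : edgeIdx F) (i : ℕ) :
    Fin k ⊕ (edgeIdx F × Fin (t - 1)) :=
  if h0 : i = 0 then Sum.inl e.1.1
  else if h : i < t then Sum.inr (e, ⟨i - 1, by omega⟩)
  else Sum.inl e.1.2

/-- The `t`-subdivision `Sub_t(F)` of a simple graph `F`: each edge is replaced by a
path of length `t` through `t−1` new internal vertices. -/
def subdiv (t : ℕ) {k : ℕ} (F : SimpleGraph (Fin k)) :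
    SimpleGraph (Fin k ⊕ (edgeIdx F × Fin (t - 1))) :=
  SimpleGraph.fromRel fun a b =>
    ∃ e : edgeIdx F, ∃ i : ℕ, i < t ∧ a = spv t e i ∧ b = spv t e (i + 1)

/-- The `t`-th power kernel `κ^t`. -/
def kpow (κ : ℝ → ℝ → ℝ) : ℕ → ℝ → ℝ → ℝ
  | 0 => fun _ _ => 0
  | 1 => κ
  | (n + 2) => fun x y => ∫ z in Icc (0:ℝ) 1, kpow κ (n + 1) x z * κ z y

/-- `φ : Fin ℓ → Fin n` is a homomorphism from `F` to `G`. -/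
def IsHom {α β : Type*} (F : SimpleGraph α) (G : SimpleGraph β) (φ : α → β) : Prop :=
  ∀ i j, F.Adj i j → G.Adj (φ i) (φ j)

/-- `F` is flat over its induced subgraph `F'` on the first `ℓ` vertices, for the
sequence `(G_n)` with normalizing function `p`. -/
def FlatOver (p : ℕ → ℝ) (G : ∀ n, SimpleGraph (Fin n)) {k ℓ : ℕ} (h : ℓ ≤ k)
    (F : SimpleGraph (Fin k)) : Prop :=
  ∀ ε > (0:ℝ), ∀ᶠ n in atTop,
    ((Finset.univ.filter (fun φ : Fin ℓ → Fin n =>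
        IsHom (F.comap (Fin.castLE h)) (G n) φ ∧
        ε * ((n:ℝ) ^ (k - ℓ) * p n ^ (edgeCount F - edgeCount (F.comap (Fin.castLE h)))) <
          |((Finset.univ.filter (fun ψ : Fin k → Fin n =>
              IsHom F (G n) ψ ∧ ψ ∘ Fin.castLE h = φ)).card : ℝ) -
            (n:ℝ) ^ (k - ℓ) * p n ^ (edgeCount F - edgeCount (F.comap (Fin.castLE h)))|)).card
      : ℝ)
      ≤ ε * ((Finset.univ.filter (fun φ : Fin ℓ → Fin n =>
          IsHom (F.comap (Fin.castLE h)) (G n) φ)).card : ℝ)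

/-- The set of density matrices of balanced partitions of `V(G)` into `k` nonempty
parts. -/
def MsetG (k : ℕ) {n : ℕ} (p : ℝ) (G : SimpleGraph (Fin n)) : Set (Fin k → Fin k → ℝ) :=
  {M | ∃ c : Fin n → Fin k, Function.Surjective c ∧
    (∀ a b, (fiber c a).card ≤ (fiber c b).card + 1) ∧
    M = fun a b => dDens p G (fiber c a) (fiber c b)}

/-- The closed set of density matrices of partitions of `[0,1]` into `k` parts of
measure `1/k`, for a kernel `κ`. -/
def MsetK (k : ℕ) (κ : ℝ → ℝ → ℝ) : Set (Fin k → Fin k → ℝ) :=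
  closure {M | ∃ Q : Fin k → Set ℝ, (∀ a, MeasurableSet (Q a)) ∧
    (Pairwise fun a b => Disjoint (Q a) (Q b)) ∧ (⋃ a, Q a) = Icc 0 1 ∧
    (∀ a, volume (Q a) = 1 / (k : ℝ≥0∞)) ∧
    M = fun a b => (k : ℝ)^2 * ∫ q in (Q a) ×ˢ (Q b), κ q.1 q.2}

end

theorem MeasureTheory.MeasurePreserving.integral_comp_of_measurable {Ω Ω' : Type*}
    [MeasurableSpace Ω] [MeasurableSpace Ω'] {μ : Measure Ω} {ν : Measure Ω'} {f : Ω → Ω'}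
    (hf : MeasurePreserving f μ ν) {g : Ω' → ℝ} (hg : Measurable g) :
    ∫ x, g (f x) ∂μ = ∫ y, g y ∂ν := by
  rw [← hf.map_eq, integral_map hf.measurable.aemeasurable hg.aestronglyMeasurable]

/-- A symmetric measurable kernel on a measurable space with values in `[0,B]`. -/
structure BoundedKernel {Ω : Type*} [MeasurableSpace Ω] (W : Ω → Ω → ℝ) (B : ℝ) : Prop where
  measurable : Measurable (Function.uncurry W)
  symm : ∀ x y, W x y = W y x
  nonneg : ∀ x y, 0 ≤ W x y
  le : ∀ x y, W x y ≤ B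

/-- Finite ordered rooted trees; `graft a b` joins the root of `b` by an edge to the root of a
new first branch `a`. -/
inductive PlaneTree : Type
  | leaf : PlaneTree
  | graft : PlaneTree → PlaneTree → PlaneTree

namespace PlaneTree

/-- The rooted tree obtained by identifying the roots of two rooted trees. -/
def mul : PlaneTree → PlaneTree → PlaneTree
  | leaf, b => b
  | graft a c, b => graft a (mul c b)

/-- The number of edges of a rooted tree. -/
def size : PlaneTree → ℕ
  | leaf => 0
  | graft a b => size a + size b + 1

/-- The homomorphism density of a rooted tree in a kernel, as a function of the image of the
root. -/
noncomputable def eval {Ω : Type*} [MeasurableSpace Ω] (μ : Measure Ω) (W : Ω → Ω → ℝ) :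
    PlaneTree → Ω → ℝ
  | leaf => fun _ => 1
  | graft a b => fun x => (∫ y, W x y * eval μ W a y ∂μ) * eval μ W b x

section

variable {Ω : Type*} [MeasurableSpace Ω] {μ : Measure Ω} {W : Ω → Ω → ℝ} {B : ℝ}

theorem eval_mul (a b : PlaneTree) (x : Ω) :
    (a.mul b).eval μ W x = a.eval μ W x * b.eval μ W x := by
  induction a with
  | leaf => simp [mul, eval]
  | graft a c _ ihc => simp [mul, eval, ihc, mul_assoc]

theorem measurable_eval [SFinite μ] (hW : Measurable (Function.uncurry W)) (t : PlaneTree) :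
    Measurable (t.eval μ W) := by
  induction t with
  | leaf => exact measurable_const
  | graft a b iha ihb =>
    refine Measurable.mul ?_ ihb
    refine (StronglyMeasurable.integral_prod_right
      (f := fun x y => W x y * a.eval μ W y) ?_).measurable
    exact (hW.mul (iha.comp measurable_snd)).stronglyMeasurable

theorem eval_nonneg (hW : ∀ x y, 0 ≤ W x y) (t : PlaneTree) (x : Ω) : 0 ≤ t.eval μ W x := by
  induction t generalizing x with
  | leaf => simp [eval]
  | graft a b iha ihb =>
    exact mul_nonneg (integral_nonneg fun y => mul_nonneg (hW x y) (iha y)) (ihb x)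

theorem eval_le [IsProbabilityMeasure μ] (hW : BoundedKernel W B) (t : PlaneTree) (x : Ω) :
    t.eval μ W x ≤ B ^ t.size := by
  induction t generalizing x with
  | leaf => simp [eval, size]
  | graft a b iha ihb =>
    have hB : 0 ≤ B := (hW.nonneg x x).trans (hW.le x x)
    have h1 : ∫ y, W x y * a.eval μ W y ∂μ ≤ B * B ^ a.size := by
      have h : ∫ y, W x y * a.eval μ W y ∂μ ≤ ∫ _, B * B ^ a.size ∂μ :=
        integral_mono_of_nonneg
          (ae_of_all _ fun y => mul_nonneg (hW.nonneg x y) (eval_nonneg hW.nonneg a y))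
          (integrable_const _)
          (ae_of_all _ fun y => mul_le_mul (hW.le x y) (iha y) (eval_nonneg hW.nonneg a y) hB)
      simpa using h
    calc (graft a b).eval μ W x = (∫ y, W x y * a.eval μ W y ∂μ) * b.eval μ W x := rfl
      _ ≤ (B * B ^ a.size) * B ^ b.size :=
        mul_le_mul h1 (ihb x) (eval_nonneg hW.nonneg b x) (by positivity)
      _ = B ^ (graft a b).size := by simp only [size]; ring

/-- The density of a rooted tree is compatible with pulling a kernel back along a
measure-preserving map. -/
theorem eval_comp {Ω' : Type*} [MeasurableSpace Ω'] {ν : Measure Ω'} [SFinite ν]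
    {f : Ω → Ω'} (hf : MeasurePreserving f μ ν) {K : Ω' → Ω' → ℝ}
    (hK : Measurable (Function.uncurry K)) (t : PlaneTree) (x : Ω) :
    t.eval μ (fun x y => K (f x) (f y)) x = t.eval ν K (f x) := by
  induction t generalizing x with
  | leaf => rfl
  | graft a b iha ihb =>
    simp only [eval, ihb, iha]
    congr 1
    have hm : Measurable fun y => K (f x) y * a.eval ν K y :=
      (hK.comp measurable_prodMk_left).mul (measurable_eval hK a)
    exact hf.integral_comp_of_measurable hm

theorem integral_eval_comp {Ω' : Type*} [MeasurableSpace Ω'] {ν : Measure Ω'} [SFinite ν]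
    {f : Ω → Ω'} (hf : MeasurePreserving f μ ν) {K : Ω' → Ω' → ℝ}
    (hK : Measurable (Function.uncurry K)) (t : PlaneTree) :
    ∫ x, t.eval μ (fun x y => K (f x) (f y)) x ∂μ = ∫ x, t.eval ν K x ∂ν := by
  simp only [eval_comp hf hK]
  exact hf.integral_comp_of_measurable (measurable_eval hK t)

end

end PlaneTree

namespace BoundedKernel

theorem comp {Ω Ω' : Type*} [MeasurableSpace Ω] [MeasurableSpace Ω'] {K : Ω' → Ω' → ℝ} {B : ℝ}
    (hK : BoundedKernel K B) {f : Ω → Ω'} (hf : Measurable f) :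
    BoundedKernel (fun x y => K (f x) (f y)) B where
  measurable := hK.measurable.comp ((hf.comp measurable_fst).prodMk (hf.comp measurable_snd))
  symm _ _ := hK.symm _ _
  nonneg _ _ := hK.nonneg _ _
  le _ _ := hK.le _ _

end BoundedKernel

/-- Bounded measurable real functions. -/
def BoundedMeasurable {Ω : Type*} [MeasurableSpace Ω] (f : Ω → ℝ) : Prop :=
  Measurable f ∧ ∃ C, ∀ x, |f x| ≤ C

namespace BoundedMeasurable

variable {Ω Ω' : Type*} [MeasurableSpace Ω] [MeasurableSpace Ω'] {f g : Ω → ℝ}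

theorem const (c : ℝ) : BoundedMeasurable fun _ : Ω => c :=
  ⟨measurable_const, |c|, fun _ => le_rfl⟩

theorem mul (hf : BoundedMeasurable f) (hg : BoundedMeasurable g) :
    BoundedMeasurable fun x => f x * g x := by
  obtain ⟨hf, C, hC⟩ := hf
  obtain ⟨hg, D, hD⟩ := hg
  refine ⟨hf.mul hg, C * D, fun x => ?_⟩
  rw [abs_mul]
  exact mul_le_mul (hC x) (hD x) (abs_nonneg _) ((abs_nonneg _).trans (hC x))

theorem add (hf : BoundedMeasurable f) (hg : BoundedMeasurable g) :
    BoundedMeasurable fun x => f x + g x := by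
  obtain ⟨hf, C, hC⟩ := hf
  obtain ⟨hg, D, hD⟩ := hg
  exact ⟨hf.add hg, C + D, fun x => (abs_add_le _ _).trans (add_le_add (hC x) (hD x))⟩

theorem neg (hf : BoundedMeasurable f) : BoundedMeasurable fun x => -f x :=
  ⟨hf.1.neg, hf.2.imp fun _ hC x => by rw [abs_neg]; exact hC x⟩

theorem sub (hf : BoundedMeasurable f) (hg : BoundedMeasurable g) :
    BoundedMeasurable fun x => f x - g x := by
  simpa only [sub_eq_add_neg] using hf.add hg.neg

theorem abs (hf : BoundedMeasurable f) : BoundedMeasurable fun x => |f x| :=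
  ⟨hf.1.abs, hf.2.imp fun _ hC x => by rw [abs_abs]; exact hC x⟩

theorem prod {ι : Type*} (s : Finset ι) {F : ι → Ω → ℝ}
    (hF : ∀ i ∈ s, BoundedMeasurable (F i)) : BoundedMeasurable fun x => ∏ i ∈ s, F i x := by
  induction s using Finset.induction_on with
  | empty => simpa using const 1
  | insert i s hi ih =>
    simp only [Finset.prod_insert hi]
    exact (hF i (Finset.mem_insert_self i s)).mul
      (ih fun j hj => hF j (Finset.mem_insert_of_mem hj))

theorem comp (hf : BoundedMeasurable f) {φ : Ω' → Ω} (hφ : Measurable φ) :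
    BoundedMeasurable fun x => f (φ x) :=
  ⟨hf.1.comp hφ, hf.2.imp fun _ hC x => hC (φ x)⟩

theorem integrable (hf : BoundedMeasurable f) (μ : Measure Ω) [IsFiniteMeasure μ] :
    Integrable f μ := by
  obtain ⟨hf, C, hC⟩ := hf
  exact Integrable.of_bound hf.aestronglyMeasurable C (ae_of_all _ hC)

theorem integral_right {U : Ω → Ω' → ℝ} (hU : BoundedMeasurable (Function.uncurry U))
    (μ : Measure Ω') [IsFiniteMeasure μ] : BoundedMeasurable fun x => ∫ y, U x y ∂μ := by
  obtain ⟨hU, C, hC⟩ := hU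
  refine ⟨hU.stronglyMeasurable.integral_prod_right'.measurable, C * μ.real univ, fun x => ?_⟩
  exact norm_integral_le_of_norm_le_const (f := U x) (ae_of_all _ fun y => hC (x, y))

end BoundedMeasurable

namespace BoundedKernel

variable {Ω : Type*} [MeasurableSpace Ω] {W : Ω → Ω → ℝ} {B : ℝ}

theorem boundedMeasurable (hW : BoundedKernel W B) : BoundedMeasurable (Function.uncurry W) :=
  ⟨hW.measurable, B, fun q => by
    simpa only [Function.uncurry, abs_of_nonneg (hW.nonneg q.1 q.2)] using hW.le q.1 q.2⟩

theorem boundedMeasurable_eval (hW : BoundedKernel W B) (μ : Measure Ω) [IsProbabilityMeasure μ]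
    (t : PlaneTree) : BoundedMeasurable (t.eval μ W) :=
  ⟨t.measurable_eval hW.measurable, B ^ t.size, fun x => by
    rw [abs_of_nonneg (t.eval_nonneg hW.nonneg x)]; exact t.eval_le hW x⟩

end BoundedKernel

section CutNorm

variable {Ω : Type*} [MeasurableSpace Ω] {μ : Measure Ω} [IsFiniteMeasure μ]

theorem setIntegral_integral_mul_le_of_cut {U : Ω → Ω → ℝ} {h : Ω → ℝ} {ε D : ℝ}
    (hU : BoundedMeasurable (Function.uncurry U)) (hh : BoundedMeasurable h)
    (hh0 : ∀ y, 0 ≤ h y) (hhD : ∀ y, h y ≤ D) (hD : 0 ≤ D)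
    (hcut : ∀ S T : Set Ω, MeasurableSet S → MeasurableSet T →
      ∫ q in S ×ˢ T, U q.1 q.2 ∂(μ.prod μ) ≤ ε) {S : Set Ω} (hS : MeasurableSet S) :
    ∫ x in S, ∫ y, U x y * h y ∂μ ∂μ ≤ D * ε := by
  have hswap : BoundedMeasurable (Function.uncurry fun y x => U x y) := hU.comp measurable_swap
  have hV := hswap.integral_right (μ.restrict S)
  set V : Ω → ℝ := fun y => ∫ x in S, U x y ∂μ
  have hT : MeasurableSet {y | 0 ≤ V y} := measurableSet_le measurable_const hV.1
  have hUh : BoundedMeasurable (Function.uncurry fun x y => U x y * h y) :=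
    hU.mul (hh.comp measurable_snd)
  calc ∫ x in S, ∫ y, U x y * h y ∂μ ∂μ = ∫ y, V y * h y ∂μ := by
        rw [integral_integral_swap (hUh.integrable _)]
        exact integral_congr_ae (ae_of_all _ fun y => integral_mul_const _ _)
    _ ≤ ∫ y, ({y | 0 ≤ V y}.indicator fun y => D * V y) y ∂μ := by
        refine integral_mono ((hV.mul hh).integrable μ)
          ((((BoundedMeasurable.const D).mul hV).integrable μ).indicator hT) fun y => ?_
        by_cases hy : 0 ≤ V y
        · simp only [indicator, mem_ofPred_eq, hy, if_true]
          rw [mul_comm]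
          exact mul_le_mul_of_nonneg_right (hhD y) hy
        · simp only [indicator, mem_ofPred_eq, hy, if_false]
          exact mul_nonpos_of_nonpos_of_nonneg (not_le.mp hy).le (hh0 y)
    _ = D * ∫ y in {y | 0 ≤ V y}, V y ∂μ := by
        rw [integral_indicator hT, integral_const_mul]
    _ = D * ∫ q in S ×ˢ {y | 0 ≤ V y}, U q.1 q.2 ∂(μ.prod μ) := by
        rw [← Measure.prod_restrict, ← integral_prod_swap]
        congr 1
        exact (integral_prod _ (hswap.integrable _)).symm
    _ ≤ D * ε := mul_le_mul_of_nonneg_left (hcut _ _ hS hT) hD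

theorem integral_abs_integral_mul_le_of_cut {U : Ω → Ω → ℝ} {h : Ω → ℝ} {ε D : ℝ}
    (hU : BoundedMeasurable (Function.uncurry U)) (hh : BoundedMeasurable h)
    (hh0 : ∀ y, 0 ≤ h y) (hhD : ∀ y, h y ≤ D) (hD : 0 ≤ D)
    (hcut : ∀ S T : Set Ω, MeasurableSet S → MeasurableSet T →
      |∫ q in S ×ˢ T, U q.1 q.2 ∂(μ.prod μ)| ≤ ε) :
    ∫ x, |∫ y, U x y * h y ∂μ| ∂μ ≤ 2 * D * ε := by
  have hUh : BoundedMeasurable (Function.uncurry fun x y => U x y * h y) :=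
    hU.mul (hh.comp measurable_snd)
  have hg := hUh.integral_right μ
  set g : Ω → ℝ := fun x => ∫ y, U x y * h y ∂μ with hgdef
  have hS : MeasurableSet {x | 0 ≤ g x} := measurableSet_le measurable_const hg.1
  rw [← integral_add_compl hS (hg.abs.integrable μ)]
  have h1 : ∫ x in {x | 0 ≤ g x}, |g x| ∂μ ≤ D * ε := by
    rw [setIntegral_congr_fun hS fun x hx => abs_of_nonneg hx]
    exact setIntegral_integral_mul_le_of_cut hU hh hh0 hhD hD
      (fun S T hS hT => (le_abs_self _).trans (hcut S T hS hT)) hS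
  have h2 : ∫ x in {x | 0 ≤ g x}ᶜ, |g x| ∂μ ≤ D * ε := by
    rw [setIntegral_congr_fun (g := fun x => ∫ y, -U x y * h y ∂μ) hS.compl fun x hx => ?_]
    · refine setIntegral_integral_mul_le_of_cut (U := fun x y => -U x y) hU.neg hh hh0 hhD hD
        (fun S T hS hT => ?_) hS.compl
      rw [integral_neg]
      exact (neg_le_abs _).trans (hcut S T hS hT)
    · simp only [mem_compl_iff, mem_ofPred_eq, not_le] at hx
      simp only [neg_mul, integral_neg]
      exact abs_of_neg hx
  linarith

theorem tendsto_integral_mul_of_bounded_mul_sq {φ ψ : ℕ → Ω → ℝ}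
    (hφ : ∀ n, BoundedMeasurable (φ n)) (hψ : ∀ n, BoundedMeasurable (ψ n))
    (hφ0 : ∀ n x, 0 ≤ φ n x) (hψ0 : ∀ n x, 0 ≤ ψ n x)
    (hlim : Tendsto (fun n => ∫ x, φ n x ∂μ) atTop (nhds 0))
    {M : ℝ} (hM : ∀ᶠ n in atTop, ∫ x, φ n x * (ψ n x * ψ n x) ∂μ ≤ M) :
    Tendsto (fun n => ∫ x, φ n x * ψ n x ∂μ) atTop (nhds 0) := by
  rw [Metric.tendsto_atTop']
  have hkey : ∀ L > 0, ∀ n, ∫ x, φ n x * ψ n x ∂μ ≤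
      L * ∫ x, φ n x ∂μ + L⁻¹ * ∫ x, φ n x * (ψ n x * ψ n x) ∂μ := by
    intro L hL n
    rw [← integral_const_mul, ← integral_const_mul, ← integral_add]
    · refine integral_mono (((hφ n).mul (hψ n)).integrable μ)
        ((((hφ n).integrable μ).const_mul _).add
        ((((hφ n).mul ((hψ n).mul (hψ n))).integrable μ).const_mul _)) fun x => ?_
      have h : ψ n x ≤ L + L⁻¹ * (ψ n x * ψ n x) := by
        have : L * L⁻¹ = 1 := mul_inv_cancel₀ hL.ne'
        have h3 : 0 ≤ L⁻¹ := inv_nonneg.mpr hL.le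
        nlinarith [mul_nonneg h3 (sq_nonneg (ψ n x - L)), hψ0 n x]
      have := mul_le_mul_of_nonneg_left h (hφ0 n x)
      linarith
    · exact ((hφ n).integrable μ).const_mul _
    · exact (((hφ n).mul ((hψ n).mul (hψ n))).integrable μ).const_mul _
  intro ε hε
  set L : ℝ := (|M| + 1) * 2 / ε with hLdef
  have hL : 0 < L := by positivity
  have hev := (hlim.eventually_lt_const (show (0:ℝ) < ε / (2 * L) by positivity)).and hM
  obtain ⟨N, hN⟩ := eventually_atTop.mp hev
  refine ⟨N, fun n hn => ?_⟩
  obtain ⟨h1, h2⟩ := hN n hn.le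
  have h0 : 0 ≤ ∫ x, φ n x * ψ n x ∂μ :=
    integral_nonneg fun x => mul_nonneg (hφ0 n x) (hψ0 n x)
  rw [Real.dist_eq, sub_zero, abs_of_nonneg h0]
  refine (hkey L hL n).trans_lt ?_
  have e1 : L * ∫ x, φ n x ∂μ < ε / 2 := by
    calc L * ∫ x, φ n x ∂μ < L * (ε / (2 * L)) := mul_lt_mul_of_pos_left h1 hL
      _ = ε / 2 := by field_simp
  have e2 : L⁻¹ * ∫ x, φ n x * (ψ n x * ψ n x) ∂μ ≤ ε / 2 := by
    calc L⁻¹ * ∫ x, φ n x * (ψ n x * ψ n x) ∂μ ≤ L⁻¹ * (|M| + 1) := by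
          refine mul_le_mul_of_nonneg_left ?_ (inv_nonneg.mpr hL.le)
          linarith [le_abs_self M]
      _ = ε / 2 := by
          rw [hLdef]
          have : |M| + 1 ≠ 0 := by positivity
          field_simp
  linarith

end CutNorm

/-- If kernels `W n` with bounded tree densities approach the uniformly bounded kernels `K n` in
cut norm, then the densities of every rooted tree approach each other in `L¹`. -/
theorem tendsto_integral_abs_eval_sub {Ω : Type*} [MeasurableSpace Ω] {μ : Measure Ω}
    [IsProbabilityMeasure μ] {W K : ℕ → Ω → Ω → ℝ} {B : ℕ → ℝ} {C : ℝ} (hC : 0 ≤ C)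
    (hW : ∀ n, BoundedKernel (W n) (B n)) (hK : ∀ n, BoundedKernel (K n) C)
    (hbdd : ∀ t : PlaneTree, ∃ M, ∀ᶠ n in atTop, ∫ x, t.eval μ (W n) x ∂μ ≤ M)
    {ε : ℕ → ℝ} (hε : Tendsto ε atTop (nhds 0))
    (hcut : ∀ n, ∀ S T : Set Ω, MeasurableSet S → MeasurableSet T →
      |∫ q in S ×ˢ T, (W n q.1 q.2 - K n q.1 q.2) ∂(μ.prod μ)| ≤ ε n) (t : PlaneTree) :
    Tendsto (fun n => ∫ x, |t.eval μ (W n) x - t.eval μ (K n) x| ∂μ) atTop (nhds 0) := by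
  have hf := fun n => (hW n).boundedMeasurable_eval μ
  have hh := fun n => (hK n).boundedMeasurable_eval μ
  have hf0 := fun n (t : PlaneTree) x => t.eval_nonneg (μ := μ) (hW n).nonneg x
  have hh0 := fun n (t : PlaneTree) x => t.eval_nonneg (μ := μ) (hK n).nonneg x
  have hhC := fun n (t : PlaneTree) x => t.eval_le (μ := μ) (hK n) x
  have hWg : ∀ n {g : Ω → ℝ}, BoundedMeasurable g →
      BoundedMeasurable (Function.uncurry fun x y => W n x y * g y) := fun n g hg =>
    (hW n).boundedMeasurable.mul (hg.comp measurable_snd)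
  have hKg : ∀ n {g : Ω → ℝ}, BoundedMeasurable g →
      BoundedMeasurable (Function.uncurry fun x y => K n x y * g y) := fun n g hg =>
    (hK n).boundedMeasurable.mul (hg.comp measurable_snd)
  induction t with
  | leaf => simp [PlaneTree.eval]
  | graft a b iha ihb =>
    have hUm : ∀ n, BoundedMeasurable (Function.uncurry fun x y => W n x y - K n x y) := fun n =>
      (hW n).boundedMeasurable.sub (hK n).boundedMeasurable
    have hUg : ∀ n {g : Ω → ℝ}, BoundedMeasurable g →
        BoundedMeasurable (Function.uncurry fun x y => (W n x y - K n x y) * g y) := fun n g hg =>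
      (hUm n).mul (hg.comp measurable_snd)
    -- the error from replacing the density of the branch
    have hbranch : Tendsto (fun n => ∫ x, |a.eval μ (W n) x - a.eval μ (K n) x| *
        (PlaneTree.graft b .leaf).eval μ (W n) x ∂μ) atTop (nhds 0) := by
      set d := PlaneTree.graft b .leaf with hd
      obtain ⟨M₁, hM₁⟩ := hbdd (a.mul (d.mul d))
      obtain ⟨M₂, hM₂⟩ := hbdd (d.mul d)
      refine tendsto_integral_mul_of_bounded_mul_sq (M := M₁ + C ^ a.size * M₂)
        (fun n => ((hf n a).sub (hh n a)).abs) (fun n => hf n d) (fun n x => abs_nonneg _)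
        (fun n x => hf0 n d x) iha ?_
      filter_upwards [hM₁, hM₂] with n h1 h2
      simp only [PlaneTree.eval_mul] at h1 h2
      have hdd := (hf n d).mul (hf n d)
      calc _ ≤ ∫ x, (a.eval μ (W n) x * (d.eval μ (W n) x * d.eval μ (W n) x) +
            C ^ a.size * (d.eval μ (W n) x * d.eval μ (W n) x)) ∂μ := by
            refine integral_mono ((((hf n a).sub (hh n a)).abs.mul hdd).integrable μ)
              ((((hf n a).mul hdd).add ((BoundedMeasurable.const _).mul hdd)).integrable μ)
              fun x => ?_
            simp only
            rw [← add_mul]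
            refine mul_le_mul_of_nonneg_right ?_ (mul_self_nonneg _)
            rw [abs_le]
            constructor <;> linarith [hf0 n a x, hh0 n a x, hhC n a x]
        _ = (∫ x, a.eval μ (W n) x * (d.eval μ (W n) x * d.eval μ (W n) x) ∂μ) +
            C ^ a.size * ∫ x, d.eval μ (W n) x * d.eval μ (W n) x ∂μ := by
            rw [integral_add (((hf n a).mul hdd).integrable μ)
              (((BoundedMeasurable.const _).mul hdd).integrable μ), integral_const_mul]
        _ ≤ _ := add_le_add h1 (mul_le_mul_of_nonneg_left h2 (by positivity))
    -- the error from replacing the kernel on the new edge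
    have hedge : Tendsto (fun n => ∫ x, |∫ y, (W n x y - K n x y) * a.eval μ (K n) y ∂μ| *
        b.eval μ (W n) x ∂μ) atTop (nhds 0) := by
      set d := PlaneTree.graft .leaf .leaf with hd
      have hdW : ∀ n x, d.eval μ (W n) x = ∫ y, W n x y ∂μ := by simp [hd, PlaneTree.eval]
      have hKle : ∀ n x, |∫ y, (W n x y - K n x y) * a.eval μ (K n) y ∂μ| ≤
          C ^ a.size * (d.eval μ (W n) x + C) := by
        intro n x
        have hWx := (hW n).boundedMeasurable.comp (measurable_prodMk_left (x := x))
        simp only [Function.uncurry_apply_pair] at hWx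
        have hrhs : ∫ y, C ^ a.size * (W n x y + C) ∂μ = C ^ a.size * (d.eval μ (W n) x + C) := by
          rw [integral_const_mul, integral_add (hWx.integrable μ) (integrable_const _), hdW]
          simp
        rw [← hrhs]
        refine (abs_integral_le_integral_abs).trans (integral_mono_of_nonneg
          (ae_of_all _ fun _ => abs_nonneg _)
          (((BoundedMeasurable.const _).mul (hWx.add (BoundedMeasurable.const C))).integrable μ)
          (ae_of_all _ fun y => ?_))
        simp only
        rw [abs_mul, abs_of_nonneg (hh0 n a y), mul_comm]
        refine mul_le_mul (hhC n a y) ?_ (abs_nonneg _) (by positivity)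
        rw [abs_le]
        constructor <;> linarith [(hW n).nonneg x y, (hK n).nonneg x y, (hK n).le x y]
      obtain ⟨M₁, hM₁⟩ := hbdd (d.mul (b.mul b))
      obtain ⟨M₂, hM₂⟩ := hbdd (b.mul b)
      refine tendsto_integral_mul_of_bounded_mul_sq (M := C ^ a.size * (M₁ + C * M₂))
        (fun n => ((hUg n (hh n a)).integral_right μ).abs) (fun n => hf n b)
        (fun n x => abs_nonneg _) (fun n x => hf0 n b x) ?_ ?_
      · refine squeeze_zero (fun n => integral_nonneg fun x => abs_nonneg _)
          (fun n => integral_abs_integral_mul_le_of_cut (hUm n) (hh n a) (hh0 n a) (hhC n a)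
            (by positivity) (hcut n)) ?_
        simpa using hε.const_mul (2 * C ^ a.size)
      · filter_upwards [hM₁, hM₂] with n h1 h2
        simp only [PlaneTree.eval_mul] at h1 h2
        have hbb := (hf n b).mul (hf n b)
        calc _ ≤ ∫ x, C ^ a.size * (d.eval μ (W n) x * (b.eval μ (W n) x * b.eval μ (W n) x) +
              C * (b.eval μ (W n) x * b.eval μ (W n) x)) ∂μ := by
              refine integral_mono
                ((((hUg n (hh n a)).integral_right μ).abs.mul hbb).integrable μ)
                (((BoundedMeasurable.const _).mul (((hf n d).mul hbb).add
                  ((BoundedMeasurable.const _).mul hbb))).integrable μ) fun x => ?_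
              simp only
              rw [← add_mul, ← mul_assoc (C ^ a.size)]
              exact mul_le_mul_of_nonneg_right (hKle n x) (mul_self_nonneg _)
          _ = C ^ a.size *
              ((∫ x, d.eval μ (W n) x * (b.eval μ (W n) x * b.eval μ (W n) x) ∂μ) +
              C * ∫ x, b.eval μ (W n) x * b.eval μ (W n) x ∂μ) := by
              rw [integral_const_mul, integral_add (((hf n d).mul hbb).integrable μ)
                (((BoundedMeasurable.const _).mul hbb).integrable μ), integral_const_mul]
          _ ≤ _ := by gcongr
    refine squeeze_zero (g := fun n =>
      (∫ x, |a.eval μ (W n) x - a.eval μ (K n) x| *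
        (PlaneTree.graft b .leaf).eval μ (W n) x ∂μ) +
      (∫ x, |∫ y, (W n x y - K n x y) * a.eval μ (K n) y ∂μ| * b.eval μ (W n) x ∂μ) +
      C ^ (a.size + 1) * ∫ x, |b.eval μ (W n) x - b.eval μ (K n) x| ∂μ)
      (fun n => integral_nonneg fun x => abs_nonneg _) (fun n => ?_)
      (by simpa using (hbranch.add hedge).add (ihb.const_mul (C ^ (a.size + 1))))
    have hδ := ((hf n a).sub (hh n a)).abs
    have hWδ := (hWg n hδ).integral_right μ
    have hswap : ∫ x, |a.eval μ (W n) x - a.eval μ (K n) x| *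
        (PlaneTree.graft b .leaf).eval μ (W n) x ∂μ =
        ∫ x, (∫ y, W n x y * |a.eval μ (W n) y - a.eval μ (K n) y| ∂μ) * b.eval μ (W n) x ∂μ := by
      simp only [PlaneTree.eval, mul_one, ← integral_const_mul, ← integral_mul_const]
      rw [integral_integral_swap]
      · refine integral_congr_ae (ae_of_all _ fun x => integral_congr_ae (ae_of_all _ fun y => ?_))
        simp only
        rw [(hW n).symm y x]
        ring
      · exact ((hδ.comp measurable_fst).mul (hWg n (hf n b))).integrable _
    rw [hswap, ← integral_const_mul, ← integral_add (hWδ.mul (hf n b) |>.integrable μ)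
      ((((hUg n (hh n a)).integral_right μ).abs.mul (hf n b)).integrable μ), ← integral_add
      (((hWδ.mul (hf n b)).add
        (((hUg n (hh n a)).integral_right μ).abs.mul (hf n b))).integrable μ)
      (((BoundedMeasurable.const _).mul ((hf n b).sub (hh n b)).abs).integrable μ)]
    refine integral_mono (((hf n (.graft a b)).sub (hh n (.graft a b))).abs.integrable μ)
      ((((hWδ.mul (hf n b)).add (((hUg n (hh n a)).integral_right μ).abs.mul (hf n b))).add
      ((BoundedMeasurable.const _).mul ((hf n b).sub (hh n b)).abs)).integrable μ) fun x => ?_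
    have hsec : ∀ {U : Ω → Ω → ℝ}, BoundedMeasurable (Function.uncurry U) →
        Integrable (U x) μ := fun hU =>
      (hU.comp (measurable_prodMk_left (x := x))).integrable μ
    have hsplit : (∫ y, W n x y * a.eval μ (W n) y ∂μ) - ∫ y, K n x y * a.eval μ (K n) y ∂μ =
        (∫ y, W n x y * (a.eval μ (W n) y - a.eval μ (K n) y) ∂μ) +
        ∫ y, (W n x y - K n x y) * a.eval μ (K n) y ∂μ := by
      rw [← integral_sub (hsec (hWg n (hf n a))) (hsec (hKg n (hh n a))), ← integral_add
        (hsec (hWg n ((hf n a).sub (hh n a)))) (hsec (hUg n (hh n a)))]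
      exact integral_congr_ae (ae_of_all _ fun y => by ring)
    have habs : |∫ y, W n x y * (a.eval μ (W n) y - a.eval μ (K n) y) ∂μ| ≤
        ∫ y, W n x y * |a.eval μ (W n) y - a.eval μ (K n) y| ∂μ := by
      refine abs_integral_le_integral_abs.trans (le_of_eq ?_)
      exact integral_congr_ae (ae_of_all _ fun y => by
        simp only [abs_mul, abs_of_nonneg ((hW n).nonneg x y)])
    have hKa : |∫ y, K n x y * a.eval μ (K n) y ∂μ| ≤ C ^ (a.size + 1) := by
      have h1 := hh0 n (.graft a .leaf) x
      have h2 := hhC n (.graft a .leaf) x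
      simp only [PlaneTree.eval, mul_one, PlaneTree.size, add_zero] at h1 h2
      rwa [abs_of_nonneg h1]
    simp only [PlaneTree.eval]
    set P := ∫ y, W n x y * a.eval μ (W n) y ∂μ
    set Q := ∫ y, K n x y * a.eval μ (K n) y ∂μ
    calc |P * b.eval μ (W n) x - Q * b.eval μ (K n) x|
        = |(P - Q) * b.eval μ (W n) x + Q * (b.eval μ (W n) x - b.eval μ (K n) x)| := by
          congr 1; ring
      _ ≤ |P - Q| * b.eval μ (W n) x + |Q| * |b.eval μ (W n) x - b.eval μ (K n) x| := by
          refine (abs_add_le _ _).trans (le_of_eq ?_)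
          rw [abs_mul, abs_mul, abs_of_nonneg (hf0 n b x)]
      _ ≤ _ := by
          rw [hsplit, ← add_mul]
          refine add_le_add (mul_le_mul_of_nonneg_right ?_ (hf0 n b x))
            (mul_le_mul_of_nonneg_right hKa (abs_nonneg _))
          exact (abs_add_le _ _).trans (add_le_add_left habs _)

section Pendant

variable {m : ℕ} {T : SimpleGraph (Fin (m + 1))} {i : Fin (m + 1)} {u : Fin m}

theorem edgeFinset_eq_of_pendant (h : ∀ w, T.Adj i w ↔ w = i.succAbove u) :
    T.edgeFinset = insert s(i, i.succAbove u)
      ((T.comap i.succAbove).edgeFinset.map i.succAboveEmb.sym2Map) := by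
  ext e
  induction e using Sym2.ind with
  | _ a b =>
  simp only [SimpleGraph.mem_edgeFinset, SimpleGraph.mem_edgeSet, Finset.mem_insert,
    Finset.mem_map, Function.Embedding.sym2Map_apply]
  constructor
  · intro hab
    by_cases ha : a = i
    · subst ha
      left
      rw [(h b).mp hab]
    by_cases hb : b = i
    · subst hb
      left
      rw [(h a).mp hab.symm, Sym2.eq_swap]
    obtain ⟨a, rfl⟩ := Fin.exists_succAbove_eq ha
    obtain ⟨b, rfl⟩ := Fin.exists_succAbove_eq hb
    exact Or.inr ⟨s(a, b), by simpa using hab, by simp⟩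
  · rintro (he | ⟨e, he, hab⟩)
    · have : T.Adj i (i.succAbove u) := (h _).mpr rfl
      rw [← SimpleGraph.mem_edgeSet] at this ⊢
      rwa [he]
    · induction e using Sym2.ind with
      | _ c d =>
      rw [← SimpleGraph.mem_edgeSet, ← hab]
      simpa using he

theorem pendant_notMem :
    s(i, i.succAbove u) ∉ (T.comap i.succAbove).edgeFinset.map i.succAboveEmb.sym2Map := by
  simp only [Finset.mem_map, Function.Embedding.sym2Map_apply, not_exists, not_and]
  intro e _ he
  induction e using Sym2.ind with
  | _ c d =>
  simp at he

theorem isTree_of_pendant (h : ∀ w, T.Adj i w ↔ w = i.succAbove u)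
    (hT : (T.comap i.succAbove).IsTree) : T.IsTree := by
  rw [SimpleGraph.isTree_iff_connected_and_card]
  constructor
  · have hreach : ∀ w, T.Reachable (i.succAbove u) w := by
      intro w
      by_cases hw : w = i
      · subst hw
        exact ((h _).mpr rfl).symm.reachable
      · obtain ⟨w, rfl⟩ := Fin.exists_succAbove_eq hw
        exact (hT.connected.preconnected u w).map
          (⟨i.succAbove, fun hab => hab⟩ : T.comap i.succAbove →g T)
    exact (SimpleGraph.connected_iff_exists_forall_reachable T).mpr ⟨_, hreach⟩
  · have h1 := hT.card_edgeFinset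
    rw [Nat.card_eq_fintype_card, ← SimpleGraph.edgeFinset_card, edgeFinset_eq_of_pendant h,
      Finset.card_insert_of_notMem pendant_notMem, Finset.card_map, h1]
    simp

end Pendant

theorem SimpleGraph.IsTree.exists_pendant {m : ℕ} {T : SimpleGraph (Fin (m + 2))}
    (hT : T.IsTree) : ∃ (i : Fin (m + 2)) (u : Fin (m + 1)),
      (∀ w, T.Adj i w ↔ w = i.succAbove u) ∧ (T.comap i.succAbove).IsTree := by
  obtain ⟨i, hi⟩ := hT.exists_vert_degree_one_of_nontrivial
  obtain ⟨v, hv, hv'⟩ := SimpleGraph.degree_eq_one_iff_existsUnique_adj.mp hi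
  obtain ⟨u, rfl⟩ := Fin.exists_succAbove_eq hv.ne.symm
  refine ⟨i, u, fun w => ⟨fun hw => hv' w hw, fun hw => hw ▸ hv⟩, ?_, ?_⟩
  · have e : T.comap i.succAbove ≃g T.induce {i}ᶜ :=
      { toEquiv := finSuccAboveEquiv i
        map_rel_iff' := by intro a b; rfl }
    exact e.connected_iff.mpr (hT.connected.induce_compl_singleton_of_degree_eq_one hi)
  · exact hT.isAcyclic.of_comap i.succAboveEmb

theorem SimpleGraph.IsTree.exists_add_pendant {m : ℕ} {T : SimpleGraph (Fin m)}
    (hT : T.IsTree) (u : Fin m) : ∃ T' : SimpleGraph (Fin (m + 1)),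
      (∀ w, T'.Adj 0 w ↔ w = (0 : Fin (m + 1)).succAbove u) ∧
      T'.comap (0 : Fin (m + 1)).succAbove = T ∧ T'.IsTree := by
  let T' : SimpleGraph (Fin (m + 1)) :=
    { Adj := fun a b => (∃ c d, T.Adj c d ∧ c.succ = a ∧ d.succ = b) ∨
        (a = 0 ∧ b = u.succ) ∨ (b = 0 ∧ a = u.succ)
      symm := by
        constructor
        rintro a b (⟨c, d, h, hc, hd⟩ | h | h)
        · exact Or.inl ⟨d, c, h.symm, hd, hc⟩
        · exact Or.inr (Or.inr h)
        · exact Or.inr (Or.inl h)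
      loopless := by
        constructor
        rintro a (⟨c, d, h, hc, hd⟩ | ⟨h, h'⟩ | ⟨h, h'⟩)
        · exact h.ne (Fin.succ_injective _ (hc.trans hd.symm))
        · exact Fin.succ_ne_zero u (h' ▸ h)
        · exact Fin.succ_ne_zero u (h' ▸ h) }
  have h1 : ∀ w, T'.Adj 0 w ↔ w = (0 : Fin (m + 1)).succAbove u := by
    intro w
    rw [Fin.succAbove_zero]
    constructor
    · rintro (⟨a, b, -, ha, -⟩ | ⟨-, h⟩ | ⟨-, h⟩)
      · exact absurd ha (Fin.succ_ne_zero a)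
      · exact h
      · exact absurd h.symm (Fin.succ_ne_zero u)
    · intro h
      exact Or.inr (Or.inl ⟨rfl, h⟩)
  have h2 : T'.comap (0 : Fin (m + 1)).succAbove = T := by
    ext a b
    simp [T']
  exact ⟨T', h1, h2, isTree_of_pendant h1 (h2 ▸ hT)⟩

/-- The weight in a kernel of an edge whose endpoints are placed according to `x`. -/
noncomputable def edgeWeight {V Ω : Type*} (W : Ω → Ω → ℝ) (x : V → Ω) : Sym2 V → ℝ :=
  Sym2.lift ⟨fun i j => (W (x i) (x j) + W (x j) (x i)) / 2,
    fun i j => by dsimp only; rw [add_comm (W (x i) (x j)) (W (x j) (x i))]⟩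

/-- The homomorphism density of a graph with rooted trees attached to its vertices. -/
noncomputable def decoratedDensity {Ω : Type*} [MeasurableSpace Ω] (μ : Measure Ω)
    (W : Ω → Ω → ℝ) {m : ℕ} (T : SimpleGraph (Fin m)) (g : Fin m → PlaneTree) : ℝ :=
  ∫ x : Fin m → Ω, (∏ e ∈ T.edgeFinset, edgeWeight W x e) *
    ∏ v, (g v).eval μ W (x v) ∂(Measure.pi fun _ => μ)

section Density

variable {Ω : Type*} [MeasurableSpace Ω] {μ : Measure Ω} [IsProbabilityMeasure μ]
  {W : Ω → Ω → ℝ} {B : ℝ}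

theorem boundedMeasurable_edgeWeight (hW : BoundedKernel W B) {m : ℕ} (e : Sym2 (Fin m)) :
    BoundedMeasurable fun x : Fin m → Ω => edgeWeight W x e := by
  induction e using Sym2.ind with
  | _ a b =>
  simp only [edgeWeight, Sym2.lift_mk, div_eq_mul_inv]
  have h : ∀ a b : Fin m, BoundedMeasurable fun x : Fin m → Ω => W (x a) (x b) := fun a b =>
    hW.boundedMeasurable.comp (φ := fun x : Fin m → Ω => (x a, x b))
      ((measurable_pi_apply a).prodMk (measurable_pi_apply b))
  exact ((h a b).add (h b a)).mul (BoundedMeasurable.const _)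

theorem decoratedDensity_eq_of_pendant (hW : BoundedKernel W B) {m : ℕ}
    {T : SimpleGraph (Fin (m + 1))} {i : Fin (m + 1)} {u : Fin m}
    (h : ∀ w, T.Adj i w ↔ w = i.succAbove u) (g : Fin (m + 1) → PlaneTree) :
    decoratedDensity μ W T g = decoratedDensity μ W (T.comap i.succAbove)
      (Function.update (fun j => g (i.succAbove j)) u (.graft (g i) (g (i.succAbove u)))) := by
  have hbm : BoundedMeasurable fun x : Fin (m + 1) → Ω =>
      (∏ e ∈ T.edgeFinset, edgeWeight W x e) * ∏ v, (g v).eval μ W (x v) :=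
    (BoundedMeasurable.prod _ fun e _ => boundedMeasurable_edgeWeight hW e).mul
      (BoundedMeasurable.prod _ fun v _ =>
        (hW.boundedMeasurable_eval μ (g v)).comp (measurable_pi_apply v))
  have hmp := (measurePreserving_piFinSuccAbove (fun _ : Fin (m + 1) => μ) i).symm
  have hbm' := hbm.comp hmp.measurable
  rw [decoratedDensity, ← hmp.integral_comp', integral_prod_symm _ (hbm'.integrable _),
    decoratedDensity]
  refine integral_congr_ae (ae_of_all _ fun y => ?_)
  have hpt : ∀ a : Ω, (∏ e ∈ T.edgeFinset, edgeWeight W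
      ((MeasurableEquiv.piFinSuccAbove (fun _ => Ω) i).symm (a, y)) e) *
      ∏ v, (g v).eval μ W ((MeasurableEquiv.piFinSuccAbove (fun _ => Ω) i).symm (a, y) v) =
      (W (y u) a * (g i).eval μ W a) *
        ((∏ e ∈ (T.comap i.succAbove).edgeFinset, edgeWeight W y e) *
          ∏ j, (g (i.succAbove j)).eval μ W (y j)) := by
    intro a
    set x := (MeasurableEquiv.piFinSuccAbove (fun _ => Ω) i).symm (a, y) with hx
    have hxi : x i = a := by simp [hx, MeasurableEquiv.piFinSuccAbove, Fin.insertNthEquiv]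
    have hxj : ∀ j, x (i.succAbove j) = y j := by
      simp [hx, MeasurableEquiv.piFinSuccAbove, Fin.insertNthEquiv]
    have hedge : ∀ e : Sym2 (Fin m), edgeWeight W x (i.succAboveEmb.sym2Map e) =
        edgeWeight W y e := by
      intro e
      induction e using Sym2.ind with
      | _ c d => simp [edgeWeight, hxj]
    rw [edgeFinset_eq_of_pendant h, Finset.prod_insert pendant_notMem, Finset.prod_map,
      Fin.prod_univ_succAbove _ i]
    simp only [hedge, hxj, hxi]
    have : edgeWeight W x s(i, i.succAbove u) = W (y u) a := by
      simp only [edgeWeight, Sym2.lift_mk, hxi, hxj, hW.symm a (y u)]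
      ring
    rw [this]
    ring
  simp only [hpt]
  rw [integral_mul_const, mul_left_comm]
  congr 1
  rw [← Finset.mul_prod_erase Finset.univ _ (Finset.mem_univ u),
    ← Finset.mul_prod_erase Finset.univ (fun v => PlaneTree.eval μ W (Function.update
      (fun j => g (i.succAbove j)) u ((g i).graft (g (i.succAbove u))) v) (y v))
      (Finset.mem_univ u), ← mul_assoc]
  congr 1
  · simp [PlaneTree.eval]
  · refine Finset.prod_congr rfl fun j hj => ?_
    rw [Function.update_of_ne (Finset.ne_of_mem_erase hj)]

theorem decoratedDensity_one (hW : BoundedKernel W B) (T : SimpleGraph (Fin 1))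
    (g : Fin 1 → PlaneTree) : decoratedDensity μ W T g = ∫ x, (g 0).eval μ W x ∂μ := by
  have hT : T.edgeFinset = ∅ := by
    rw [SimpleGraph.edgeFinset_eq_empty]
    exact Subsingleton.elim _ _
  simp only [decoratedDensity, hT, Finset.prod_empty, one_mul, Fin.prod_univ_one]
  exact (measurePreserving_eval (fun _ : Fin 1 => μ) 0).integral_comp_of_measurable
    ((g 0).measurable_eval hW.measurable)

end Density

/-- The density of a tree decorated by rooted trees is the density of a rooted tree. -/
theorem exists_planeTree_decoratedDensity {m : ℕ} {T : SimpleGraph (Fin m)} (hT : T.IsTree)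
    (g : Fin m → PlaneTree) : ∃ t : PlaneTree, ∀ (Ω : Type) [MeasurableSpace Ω] (μ : Measure Ω)
      [IsProbabilityMeasure μ] (W : Ω → Ω → ℝ) (B : ℝ), BoundedKernel W B →
      decoratedDensity μ W T g = ∫ x, t.eval μ W x ∂μ := by
  induction m with
  | zero => exact hT.connected.nonempty.elim fun v => v.elim0
  | succ m ih =>
    cases m with
    | zero => exact ⟨g 0, fun Ω _ μ _ W B hW => decoratedDensity_one hW T g⟩
    | succ m =>
      obtain ⟨i, u, hu, hT'⟩ := hT.exists_pendant
      obtain ⟨t, ht⟩ := ih hT' (Function.update (fun j => g (i.succAbove j)) u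
        (.graft (g i) (g (i.succAbove u))))
      exact ⟨t, fun Ω _ μ _ W B hW =>
        (decoratedDensity_eq_of_pendant hW hu g).trans (ht Ω μ W B hW)⟩

/-- The density of a tree decorated by rooted trees is the density of an undecorated tree. -/
theorem exists_tree_decoratedDensity {m : ℕ} {T : SimpleGraph (Fin m)} (hT : T.IsTree)
    (g : Fin m → PlaneTree) : ∃ (k : ℕ) (T' : SimpleGraph (Fin k)), T'.IsTree ∧
      ∀ (Ω : Type) [MeasurableSpace Ω] (μ : Measure Ω)
      [IsProbabilityMeasure μ] (W : Ω → Ω → ℝ) (B : ℝ), BoundedKernel W B →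
      decoratedDensity μ W T g = decoratedDensity μ W T' fun _ => .leaf := by
  induction hs : ∑ v, (g v).size generalizing m with
  | zero =>
    refine ⟨m, T, hT, fun Ω _ μ _ W B hW => ?_⟩
    have hg : g = fun _ => .leaf := by
      funext v
      have := (Finset.sum_eq_zero_iff.mp hs) v (Finset.mem_univ v)
      cases hv : g v with
      | leaf => rfl
      | graft a b => simp [hv, PlaneTree.size] at this
    rw [hg]
  | succ s ih =>
    have : ∃ u, (g u).size ≠ 0 := by
      by_contra! hall
      simp [hall] at hs
    obtain ⟨u, hu⟩ := this
    cases hgu : g u with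
    | leaf => simp [hgu, PlaneTree.size] at hu
    | graft a b =>
      obtain ⟨T₁, h1, h2, h3⟩ := hT.exists_add_pendant u
      obtain ⟨k, T', hT', hd⟩ := ih h3 (Fin.cons a (Function.update g u b)) (by
        rw [Fin.sum_univ_succ]
        simp only [Fin.cons_zero, Fin.cons_succ]
        rw [← Finset.add_sum_erase Finset.univ _ (Finset.mem_univ u)] at hs ⊢
        rw [Finset.sum_congr rfl fun j hj => by
          rw [Function.update_of_ne (Finset.ne_of_mem_erase hj)]]
        simp only [hgu, PlaneTree.size, Function.update_self] at hs ⊢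
        omega)
      refine ⟨k, T', hT', fun Ω _ μ _ W B hW => ?_⟩
      rw [← hd Ω μ W B hW, decoratedDensity_eq_of_pendant hW h1, h2]
      congr 1
      funext j
      by_cases hj : j = u
      · subst hj; simp [hgu]
      · simp [hj]

/-- Every rooted tree density is the homomorphism density of a tree. -/
theorem PlaneTree.exists_tree (t : PlaneTree) : ∃ (k : ℕ) (T : SimpleGraph (Fin k)), T.IsTree ∧
    ∀ (Ω : Type) [MeasurableSpace Ω] (μ : Measure Ω)
    [IsProbabilityMeasure μ] (W : Ω → Ω → ℝ) (B : ℝ), BoundedKernel W B →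
    decoratedDensity μ W T (fun _ => .leaf) = ∫ x, t.eval μ W x ∂μ := by
  obtain ⟨k, T, hT, h⟩ := exists_tree_decoratedDensity
    (T := (⊥ : SimpleGraph (Fin 1))) .of_subsingleton (fun _ => t)
  exact ⟨k, T, hT, fun Ω _ μ _ W B hW =>
    (h Ω μ W B hW).symm.trans (decoratedDensity_one hW _ _)⟩

section Counting

theorem homCount_eq_card {α β : Type*} [Fintype α] [Fintype β] [DecidableEq α] [DecidableEq β]
    (F : SimpleGraph α) (G : SimpleGraph β) :
    homCount F G = (Finset.univ.filter fun φ : α → β => IsHom F G φ).card := by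
  rw [homCount, ← Fintype.card_subtype, ← Nat.card_eq_fintype_card]
  exact Nat.card_congr
    { toFun := fun φ => ⟨φ, fun i j h => φ.map_rel h⟩
      invFun := fun φ => ⟨φ.1, fun h => φ.2 _ _ h⟩
      left_inv := fun _ => rfl
      right_inv := fun _ => rfl }

theorem embCount_eq_card {α β : Type*} [Fintype α] [Fintype β] [DecidableEq α] [DecidableEq β]
    (F : SimpleGraph α) (G : SimpleGraph β) : embCount F G =
      (Finset.univ.filter fun φ : α → β => IsHom F G φ ∧ Function.Injective φ).card := by
  rw [embCount, ← Fintype.card_subtype, ← Nat.card_eq_fintype_card]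
  exact Nat.card_congr
    { toFun := fun φ => ⟨φ.1, fun i j h => φ.1.map_rel h, φ.2⟩
      invFun := fun φ => ⟨⟨φ.1, fun h => φ.2.1 _ _ h⟩, φ.2.2⟩
      left_inv := fun _ => rfl
      right_inv := fun _ => rfl }

theorem embCount_le_homCount {α β : Type*} [Fintype α] [Fintype β] (F : SimpleGraph α)
    (G : SimpleGraph β) : embCount F G ≤ homCount F G := by
  rw [homCount_eq_card, embCount_eq_card]
  exact Finset.card_le_card (Finset.monotone_filter_right _ fun _ _ h => h.1)

theorem SimpleGraph.IsTree.edgeCount_add_one {k : ℕ} {T : SimpleGraph (Fin k)}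
    (hT : T.IsTree) : edgeCount T + 1 = k := by
  rw [edgeCount, Nat.card_eq_fintype_card, ← SimpleGraph.edgeFinset_card, hT.card_edgeFinset,
    Fintype.card_fin]

/-- The image of a connected graph under a surjection has a spanning tree. -/
theorem SimpleGraph.Connected.exists_isTree_of_surjective {α β : Type*} [Finite β]
    {T : SimpleGraph α} (hT : T.Connected) {q : α → β} (hq : Function.Surjective q) :
    ∃ S : SimpleGraph β, S.IsTree ∧ ∀ a b, S.Adj a b → ∃ c d, T.Adj c d ∧ q c = a ∧ q d = b := by
  let H : SimpleGraph β :=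
    { Adj := fun a b => a ≠ b ∧ ∃ c d, T.Adj c d ∧ q c = a ∧ q d = b
      symm := ⟨fun a b ⟨hab, c, d, h, hc, hd⟩ => ⟨hab.symm, d, c, h.symm, hd, hc⟩⟩
      loopless := ⟨fun a h => h.1 rfl⟩ }
  have hstep : ∀ c d, T.Adj c d → H.Reachable (q c) (q d) := by
    intro c d h
    by_cases hcd : q c = q d
    · rw [hcd]
    · exact SimpleGraph.Adj.reachable (G := H) ⟨hcd, c, d, h, rfl, rfl⟩
  have hwalk : ∀ c d, T.Walk c d → H.Reachable (q c) (q d) := by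
    intro c d w
    induction w with
    | nil => rfl
    | cons h _ ih => exact (hstep _ _ h).trans ih
  have hH : H.Connected := by
    have : Nonempty β := hT.nonempty.map q
    refine ⟨fun a b => ?_⟩
    obtain ⟨c, rfl⟩ := hq a
    obtain ⟨d, rfl⟩ := hq b
    exact (hT.preconnected c d).elim fun w => hwalk c d w
  obtain ⟨S, hS, hS'⟩ := hH.exists_isTree_le
  exact ⟨S, hS', fun a b hab => (hS hab).2⟩

/-- Homomorphisms of a tree that are not injective factor through embeddings of trees with fewer
vertices. -/
theorem SimpleGraph.IsTree.exists_homCount_le {k : ℕ} {T : SimpleGraph (Fin k)} (hT : T.IsTree) :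
    ∃ S : (j : ℕ) → (Fin k → Fin j) → SimpleGraph (Fin j),
      (∀ j q, Function.Surjective q → (S j q).IsTree) ∧
      ∀ (n : ℕ) (G : SimpleGraph (Fin n)), homCount T G ≤ embCount T G +
        ∑ j ∈ Finset.range k, ∑ q : Fin k → Fin j with Function.Surjective q,
          embCount (S j q) G := by
  have hex : ∀ (j : ℕ) (q : Fin k → Fin j), ∃ S : SimpleGraph (Fin j), Function.Surjective q →
      S.IsTree ∧ ∀ a b, S.Adj a b → ∃ c d, T.Adj c d ∧ q c = a ∧ q d = b := by
    intro j q
    by_cases hq : Function.Surjective q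
    · obtain ⟨S, hS⟩ := hT.connected.exists_isTree_of_surjective hq
      exact ⟨S, fun _ => hS⟩
    · exact ⟨⊥, fun h => absurd h hq⟩
  choose S hS using hex
  refine ⟨S, fun j q hq => (hS j q hq).1, fun n G => ?_⟩
  have hsub : (Finset.univ.filter fun φ : Fin k → Fin n => IsHom T G φ) ⊆
      (Finset.univ.filter fun φ : Fin k → Fin n => IsHom T G φ ∧ Function.Injective φ) ∪
      (Finset.range k).biUnion fun j =>
        (Finset.univ.filter fun q : Fin k → Fin j => Function.Surjective q).biUnion fun q =>
          (Finset.univ.filter fun ψ : Fin j → Fin n =>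
            IsHom (S j q) G ψ ∧ Function.Injective ψ).image fun ψ => ψ ∘ q := by
    intro φ hφ
    have hφ : IsHom T G φ := by simpa using hφ
    by_cases hinj : Function.Injective φ
    · simp [hφ, hinj]
    refine Finset.mem_union_right _ ?_
    have hcard : Fintype.card (range φ) < k := by
      have h1 := Fintype.card_range_le φ
      rw [Fintype.card_fin] at h1
      refine lt_of_le_of_ne h1 fun h => hinj ?_
      have hbij : Function.Bijective (rangeFactorization φ) :=
        (Fintype.bijective_iff_surjective_and_card _).mpr
          ⟨rangeFactorization_surjective, by rw [h, Fintype.card_fin]⟩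
      intro a b hab
      exact hbij.1 (Subtype.ext hab)
    let e := Fintype.equivFin (range φ)
    have hq : Function.Surjective (e ∘ rangeFactorization φ) :=
      e.surjective.comp rangeFactorization_surjective
    simp only [Finset.mem_biUnion, Finset.mem_range, Finset.mem_image, Finset.mem_filter,
      Finset.mem_univ, true_and]
    refine ⟨_, hcard, e ∘ rangeFactorization φ, hq, fun i => (e.symm i : Fin n), ⟨?_, ?_⟩, ?_⟩
    · intro a b hab
      obtain ⟨c, d, hcd, rfl, rfl⟩ := (hS _ _ hq).2 a b hab
      simpa using hφ c d hcd
    · exact Subtype.val_injective.comp e.symm.injective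
    · funext a
      simp
  rw [homCount_eq_card, embCount_eq_card]
  refine (Finset.card_le_card hsub).trans ((Finset.card_union_le _ _).trans ?_)
  refine Nat.add_le_add_left (Finset.card_biUnion_le.trans ?_) _
  refine Finset.sum_le_sum fun j _ => Finset.card_biUnion_le.trans ?_
  refine Finset.sum_le_sum fun q _ => Finset.card_image_le.trans ?_
  rw [embCount_eq_card]

theorem embCount_div_le {j n : ℕ} {S : SimpleGraph (Fin j)} {G : SimpleGraph (Fin n)} {p M : ℝ}
    (hp : 0 < p) (h : sDen p S G ≤ M) :
    (embCount S G : ℝ) / (p ^ edgeCount S * (n : ℝ) ^ j) ≤ |M| := by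
  rcases lt_or_ge n j with hnj | hnj
  · have : embCount S G = 0 := by
      rw [embCount_eq_card, Finset.card_eq_zero, Finset.filter_eq_empty_iff]
      rintro φ - ⟨-, hφ⟩
      have := Fintype.card_le_of_injective φ hφ
      simp only [Fintype.card_fin] at this
      omega
    simp [this]
  · refine le_trans ?_ (h.trans (le_abs_self M))
    simp only [sDen, Fintype.card_fin]
    have hpos : (0 : ℝ) < n.descFactorial j := by
      exact_mod_cast Nat.descFactorial_pos.mpr hnj
    have hle : (n.descFactorial j : ℝ) ≤ (n : ℝ) ^ j := by
      exact_mod_cast Nat.descFactorial_le_pow n j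
    gcongr

variable {p : ℕ → ℝ} {G : ∀ n, SimpleGraph (Fin n)}

theorem tendsto_embCount_div_of_lt (hp : ∀ n, 0 < p n)
    (hpn : Tendsto (fun n : ℕ => (n : ℝ) * p n) atTop atTop)
    (htree : ∀ (m : ℕ) (T : SimpleGraph (Fin m)), T.IsTree →
      ∃ M : ℝ, ∀ n, sDen (p n) T (G n) ≤ M)
    {j k : ℕ} (hjk : j < k) {S : SimpleGraph (Fin j)} (hS : S.IsTree) :
    Tendsto (fun n => (embCount S (G n) : ℝ) / (p n ^ (k - 1) * (n : ℝ) ^ k)) atTop (nhds 0) := by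
  obtain ⟨M, hM⟩ := htree j S hS
  have hpow : Tendsto (fun n : ℕ => |M| * (((n : ℝ) * p n)⁻¹) ^ (k - j)) atTop (nhds 0) := by
    have := (hpn.inv_tendsto_atTop.pow (k - j)).const_mul |M|
    rwa [zero_pow (by omega), mul_zero] at this
  refine squeeze_zero (fun n => ?_) (fun n => ?_) hpow
  · have := (hp n).le
    positivity
  · refine le_trans (le_of_eq ?_) (mul_le_mul_of_nonneg_right (embCount_div_le (hp n) (hM n))
      (pow_nonneg (inv_nonneg.mpr (mul_nonneg n.cast_nonneg (hp n).le)) _))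
    have hj := hS.edgeCount_add_one
    have h1 : p n ^ (k - 1) = p n ^ edgeCount S * p n ^ (k - j) := by
      rw [← pow_add]
      congr 1
      omega
    have h2 : (n : ℝ) ^ k = (n : ℝ) ^ j * (n : ℝ) ^ (k - j) := by
      rw [← pow_add]
      congr 1
      omega
    rw [h1, h2, inv_pow, mul_pow, ← div_eq_mul_inv, div_div]
    congr 1
    ring

theorem tendsto_homCount_sub_embCount_div (hp : ∀ n, 0 < p n)
    (hpn : Tendsto (fun n : ℕ => (n : ℝ) * p n) atTop atTop)
    (htree : ∀ (m : ℕ) (T : SimpleGraph (Fin m)), T.IsTree →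
      ∃ M : ℝ, ∀ n, sDen (p n) T (G n) ≤ M)
    {k : ℕ} {T : SimpleGraph (Fin k)} (hT : T.IsTree) :
    Tendsto (fun n => tDen (p n) T (G n) -
      (embCount T (G n) : ℝ) / (p n ^ edgeCount T * (n : ℝ) ^ k)) atTop (nhds 0) := by
  obtain ⟨S, hS, hle⟩ := hT.exists_homCount_le
  have hsum : Tendsto (fun n => ∑ j ∈ Finset.range k,
      ∑ q : Fin k → Fin j with Function.Surjective q,
        (embCount (S j q) (G n) : ℝ) / (p n ^ (k - 1) * (n : ℝ) ^ k)) atTop (nhds 0) := by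
    rw [show (0 : ℝ) = ∑ j ∈ Finset.range k,
      ∑ q : Fin k → Fin j with Function.Surjective q, (0 : ℝ) by simp]
    refine tendsto_finsetSum _ fun j hj => tendsto_finsetSum _ fun q hq => ?_
    exact tendsto_embCount_div_of_lt hp hpn htree (Finset.mem_range.mp hj)
      (hS j q (Finset.mem_filter.mp hq).2)
  have hedge : edgeCount T = k - 1 := by
    have := hT.edgeCount_add_one
    omega
  refine squeeze_zero (fun n => ?_) (fun n => ?_) hsum
  all_goals
    have hpos : 0 ≤ p n ^ edgeCount T * (n : ℝ) ^ k := by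
      have := (hp n).le
      positivity
    simp only [tDen, Fintype.card_fin]
    rw [← sub_div]
  · refine div_nonneg (sub_nonneg.mpr ?_) hpos
    exact_mod_cast embCount_le_homCount T (G n)
  · rw [← hedge]
    simp only [← Finset.sum_div]
    refine div_le_div_of_nonneg_right ?_ hpos
    rw [sub_le_iff_le_add']
    exact_mod_cast hle n (G n)

theorem exists_eventually_tDen_le (hp : ∀ n, 0 < p n)
    (hpn : Tendsto (fun n : ℕ => (n : ℝ) * p n) atTop atTop)
    (htree : ∀ (m : ℕ) (T : SimpleGraph (Fin m)), T.IsTree →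
      ∃ M : ℝ, ∀ n, sDen (p n) T (G n) ≤ M)
    {k : ℕ} {T : SimpleGraph (Fin k)} (hT : T.IsTree) :
    ∃ M : ℝ, ∀ᶠ n in atTop, tDen (p n) T (G n) ≤ M := by
  obtain ⟨M, hM⟩ := htree k T hT
  refine ⟨1 + |M|, ?_⟩
  filter_upwards [(tendsto_homCount_sub_embCount_div hp hpn htree hT).eventually_le_const
    zero_lt_one] with n hn
  have := embCount_div_le (hp n) (hM n)
  linarith

/-- Convergence of the normalized homomorphism counts of a tree implies convergence of its
normalized embedding counts. -/
theorem tendsto_sDen_of_tendsto_tDen (hp : ∀ n, 0 < p n)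
    (hpn : Tendsto (fun n : ℕ => (n : ℝ) * p n) atTop atTop)
    (htree : ∀ (m : ℕ) (T : SimpleGraph (Fin m)), T.IsTree →
      ∃ M : ℝ, ∀ n, sDen (p n) T (G n) ≤ M)
    {k : ℕ} {T : SimpleGraph (Fin k)} (hT : T.IsTree) {a : ℝ}
    (h : Tendsto (fun n => tDen (p n) T (G n)) atTop (nhds a)) :
    Tendsto (fun n => sDen (p n) T (G n)) atTop (nhds a) := by
  have hemb := h.sub (tendsto_homCount_sub_embCount_div hp hpn htree hT)
  have hratio : Tendsto (fun n : ℕ => ((n : ℝ) ^ k) / (n.descFactorial k : ℝ)) atTop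
      (nhds 1) := by
    refine (Asymptotics.isEquivalent_iff_tendsto_one ?_).mp (isEquivalent_descFactorial k).symm
    filter_upwards [eventually_ge_atTop k] with n hn
    exact_mod_cast (Nat.descFactorial_pos.mpr hn).ne'
  have := hemb.mul hratio
  rw [sub_zero, mul_one] at this
  refine this.congr' ?_
  filter_upwards [eventually_ge_atTop (k + 1)] with n hn
  have h1 : (n.descFactorial k : ℝ) ≠ 0 := by
    exact_mod_cast (Nat.descFactorial_pos.mpr (by omega)).ne'
  have h2 : (n : ℝ) ≠ 0 := by
    exact_mod_cast (by omega : n ≠ 0)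
  have h3 := (hp n).ne'
  simp only [sDen, Fintype.card_fin, sub_sub_cancel]
  field_simp

end Counting

section GraphKernel

instance isProbabilityMeasure_restrict_Icc_zero_one :
    IsProbabilityMeasure (volume.restrict (Icc (0 : ℝ) 1)) :=
  ⟨by simp⟩

theorem measurable_idx (n : ℕ) : Measurable (idx n) :=
  (measurable_from_top (f := fun m : ℕ => m - 1)).comp
    (Nat.measurable_ceil.comp (measurable_id.mul_const (n : ℝ)))

theorem idx_eq_iff {n i : ℕ} (hn : 0 < n) {x : ℝ} (hx : 0 < x) :
    idx n x = i ↔ x ∈ Ioc ((i : ℝ) / n) (((i : ℝ) + 1) / n) := by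
  have hn' : (0 : ℝ) < n := by exact_mod_cast hn
  have hpos : 0 < ⌈x * n⌉₊ := Nat.ceil_pos.mpr (mul_pos hx hn')
  rw [mem_Ioc, div_lt_iff₀ hn', le_div_iff₀ hn', ← Nat.lt_ceil,
    show (i : ℝ) + 1 = ((i + 1 : ℕ) : ℝ) by push_cast; rfl, ← Nat.ceil_le, idx]
  omega

theorem idx_lt {n : ℕ} (hn : 0 < n) {x : ℝ} (hx : x ∈ Ioc (0 : ℝ) 1) : idx n x < n := by
  have hn' : (0 : ℝ) < n := by exact_mod_cast hn
  have h : ⌈x * n⌉₊ ≤ n := Nat.ceil_le.mpr (mul_le_of_le_one_left hn'.le hx.2)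
  rw [idx]
  omega

/-- The vertex of a graph on `Fin (n + 1)` whose interval contains a point of `(0, 1]`. -/
noncomputable def vertexAt (n : ℕ) (x : ℝ) : Fin (n + 1) := Fin.ofNat (n + 1) (idx (n + 1) x)

theorem measurable_vertexAt (n : ℕ) : Measurable (vertexAt n) :=
  measurable_from_top.comp (measurable_idx _)

theorem vertexAt_eq (n : ℕ) {x : ℝ} (hx : x ∈ Ioc (0 : ℝ) 1) :
    vertexAt n x = ⟨idx (n + 1) x, idx_lt n.succ_pos hx⟩ :=
  Fin.ext (Nat.mod_eq_of_lt (idx_lt n.succ_pos hx))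

/-- The uniform measure on the vertices of a graph on `Fin (n + 1)`. -/
noncomputable def vertexMeasure (n : ℕ) : Measure (Fin (n + 1)) :=
  (volume.restrict (Icc (0 : ℝ) 1)).map (vertexAt n)

theorem measurePreserving_vertexAt (n : ℕ) :
    MeasurePreserving (vertexAt n) (volume.restrict (Icc (0 : ℝ) 1)) (vertexMeasure n) :=
  ⟨measurable_vertexAt n, rfl⟩

instance isProbabilityMeasure_vertexMeasure (n : ℕ) : IsProbabilityMeasure (vertexMeasure n) :=
  Measure.isProbabilityMeasure_map (measurable_vertexAt n).aemeasurable

theorem vertexMeasure_singleton (n : ℕ) (i : Fin (n + 1)) :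
    vertexMeasure n {i} = ENNReal.ofReal ((n : ℝ) + 1)⁻¹ := by
  rw [vertexMeasure, Measure.map_apply (measurable_vertexAt n) (measurableSet_singleton i),
    ← Measure.restrict_congr_set (Ioc_ae_eq_Icc (μ := volume) (a := (0 : ℝ)) (b := 1)),
    Measure.restrict_apply (measurable_vertexAt n (measurableSet_singleton i))]
  have hn : (0 : ℝ) < n + 1 := by positivity
  have hset : vertexAt n ⁻¹' {i} ∩ Ioc (0 : ℝ) 1 =
      Ioc ((i : ℝ) / (n + 1 : ℕ)) (((i : ℝ) + 1) / (n + 1 : ℕ)) := by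
    ext x
    constructor
    · rintro ⟨h, hx⟩
      rw [mem_preimage, vertexAt_eq n hx, mem_singleton_iff, Fin.ext_iff] at h
      exact (idx_eq_iff n.succ_pos hx.1).mp h
    · intro h
      have hx : x ∈ Ioc (0 : ℝ) 1 := by
        refine ⟨lt_of_le_of_lt (by positivity) h.1, h.2.trans ?_⟩
        rw [div_le_one (by exact_mod_cast n.succ_pos)]
        exact_mod_cast i.2
      refine ⟨?_, hx⟩
      rw [mem_preimage, vertexAt_eq n hx, mem_singleton_iff, Fin.ext_iff]
      exact (idx_eq_iff n.succ_pos hx.1).mpr h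
  rw [hset, Real.volume_Ioc]
  congr 1
  push_cast
  field_simp
  ring

/-- The adjacency matrix of a graph, normalized by `p`, as a kernel on the vertices. -/
noncomputable def adjKernel {n : ℕ} (p : ℝ) (G : SimpleGraph (Fin n)) : Fin n → Fin n → ℝ :=
  fun i j => if G.Adj i j then 1 / p else 0

theorem boundedKernel_adjKernel {n : ℕ} {p : ℝ} (hp : 0 < p) (G : SimpleGraph (Fin n)) :
    BoundedKernel (adjKernel p G) (1 / p) where
  measurable := measurable_of_finite _
  symm i j := by simp only [adjKernel, G.adj_comm]
  nonneg i j := by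
    unfold adjKernel
    split_ifs <;> positivity
  le i j := by
    unfold adjKernel
    split_ifs
    · exact le_rfl
    · positivity

theorem graphKernel_eq {n : ℕ} (p : ℝ) (G : SimpleGraph (Fin (n + 1))) {x y : ℝ}
    (hx : x ∈ Ioc (0 : ℝ) 1) (hy : y ∈ Ioc (0 : ℝ) 1) :
    graphKernel p G x y = adjKernel p G (vertexAt n x) (vertexAt n y) := by
  rw [graphKernel, dif_pos ⟨hx, hy, idx_lt n.succ_pos hx, idx_lt n.succ_pos hy⟩, adjKernel,
    vertexAt_eq n hx, vertexAt_eq n hy]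

theorem abs_graphKernel_le {n : ℕ} {p : ℝ} (hp : 0 < p) (G : SimpleGraph (Fin n)) (x y : ℝ) :
    |graphKernel p G x y| ≤ 1 / p := by
  unfold graphKernel
  split_ifs
  · rw [abs_of_pos (by positivity)]
  · rw [abs_zero]; positivity
  · rw [abs_zero]; positivity

theorem prod_edgeWeight_adjKernel {k n : ℕ} (p : ℝ) (T : SimpleGraph (Fin k))
    (G : SimpleGraph (Fin n)) (φ : Fin k → Fin n) :
    ∏ e ∈ T.edgeFinset, edgeWeight (adjKernel p G) φ e =
      if IsHom T G φ then (1 / p) ^ edgeCount T else 0 := by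
  have hedge : ∀ i j, edgeWeight (adjKernel p G) φ s(i, j) =
      if G.Adj (φ i) (φ j) then 1 / p else 0 := by
    intro i j
    simp only [edgeWeight, Sym2.lift_mk, adjKernel, G.adj_comm (φ j) (φ i)]
    ring
  split_ifs with h
  · rw [edgeCount, Nat.card_eq_fintype_card, ← SimpleGraph.edgeFinset_card]
    refine Finset.prod_eq_pow_card fun e he => ?_
    induction e using Sym2.ind with
    | _ i j => rw [hedge, if_pos (h i j (by simpa using he))]
  · simp only [IsHom, not_forall] at h
    obtain ⟨i, j, hij, hG⟩ := h
    refine Finset.prod_eq_zero (i := s(i, j)) (by simpa using hij) ?_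
    rw [hedge, if_neg hG]

theorem decoratedDensity_adjKernel {k n : ℕ} (p : ℝ) (T : SimpleGraph (Fin k))
    (G : SimpleGraph (Fin (n + 1))) :
    decoratedDensity (vertexMeasure n) (adjKernel p G) T (fun _ => .leaf) = tDen p T G := by
  have hpi : ∀ φ : Fin k → Fin (n + 1),
      (Measure.pi fun _ : Fin k => vertexMeasure n).real {φ} = (((n : ℝ) + 1)⁻¹) ^ k := by
    intro φ
    rw [measureReal_def, Measure.pi_singleton]
    simp only [vertexMeasure_singleton, Finset.prod_const, Finset.card_univ, Fintype.card_fin]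
    rw [ENNReal.toReal_pow, ENNReal.toReal_ofReal (by positivity)]
  rw [decoratedDensity, integral_fintype .of_finite]
  simp only [hpi, prod_edgeWeight_adjKernel, PlaneTree.eval, Finset.prod_const_one, mul_one,
    smul_eq_mul, mul_ite, mul_zero]
  rw [← Finset.sum_filter, Finset.sum_const, nsmul_eq_mul, ← homCount_eq_card, tDen]
  simp only [Fintype.card_fin, Nat.cast_add, Nat.cast_one, one_div, inv_pow]
  rw [div_eq_mul_inv, mul_inv_rev]

end GraphKernel

section CutDistance

theorem homDensity_eq_decoratedDensity {k : ℕ} (T : SimpleGraph (Fin k)) (κ : ℝ → ℝ → ℝ) :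
    homDensity T κ =
      decoratedDensity (volume.restrict (Icc (0 : ℝ) 1)) κ T (fun _ => .leaf) := by
  rw [homDensity, decoratedDensity, volume_pi, Measure.restrict_pi_pi]
  simp only [PlaneTree.eval, Finset.prod_const_one, mul_one]
  rfl

theorem abs_setIntegral_le_cutNorm {W : ℝ → ℝ → ℝ} {B : ℝ} (hW : ∀ x y, |W x y| ≤ B)
    {S T : Set ℝ} (hS : MeasurableSet S) (hT : MeasurableSet T) (hS1 : S ⊆ Icc 0 1)
    (hT1 : T ⊆ Icc 0 1) : |∫ q in S ×ˢ T, W q.1 q.2| ≤ cutNorm W := by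
  refine le_csSup ⟨B, ?_⟩ ⟨S, T, hS, hT, hS1, hT1, rfl⟩
  rintro r ⟨S, T, -, -, hS1, hT1, rfl⟩
  have hB : 0 ≤ B := (abs_nonneg _).trans (hW 0 0)
  have hvol : volume (S ×ˢ T) ≤ 1 := by
    refine (measure_mono (prod_mono hS1 hT1)).trans ?_
    rw [Measure.volume_eq_prod, Measure.prod_prod]
    simp
  refine (norm_setIntegral_le_of_norm_le_const (f := fun q : ℝ × ℝ => W q.1 q.2)
    (hvol.trans_lt ENNReal.one_lt_top) fun q _ => hW q.1 q.2).trans (mul_le_of_le_one_right hB ?_)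
  rw [measureReal_def]
  exact ENNReal.toReal_le_of_le_ofReal zero_le_one (by simpa using hvol)

theorem mpBij_id : MPBij id := ⟨MeasurePreserving.id _, bijOn_id _⟩

theorem exists_mpBij_cutNorm_lt (κ₁ κ₂ : ℝ → ℝ → ℝ) {ε : ℝ} (hε : 0 < ε) :
    ∃ τ : ℝ → ℝ, MPBij τ ∧
      cutNorm (fun x y => κ₁ x y - κ₂ (τ x) (τ y)) < cutDist κ₁ κ₂ + ε := by
  obtain ⟨r, ⟨τ, hτ, rfl⟩, hr⟩ := exists_lt_of_csInf_lt
    (s := {r | ∃ τ : ℝ → ℝ, MPBij τ ∧ r = cutNorm (fun x y => κ₁ x y - κ₂ (τ x) (τ y))})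
    ⟨_, id, mpBij_id, rfl⟩ (lt_add_of_pos_right (cutDist κ₁ κ₂) hε)
  exact ⟨τ, hτ, hr⟩

theorem abs_setIntegral_adjKernel_sub_le {n : ℕ} {p : ℝ} (hp : 0 < p)
    (G : SimpleGraph (Fin (n + 1))) {K : ℝ → ℝ → ℝ} {C : ℝ} (hK : ∀ x y, |K x y| ≤ C)
    {S T : Set ℝ} (hS : MeasurableSet S) (hT : MeasurableSet T) :
    |∫ q in S ×ˢ T, (adjKernel p G (vertexAt n q.1) (vertexAt n q.2) - K q.1 q.2)
      ∂((volume.restrict (Icc (0 : ℝ) 1)).prod (volume.restrict (Icc (0 : ℝ) 1)))| ≤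
      cutNorm fun x y => graphKernel p G x y - K x y := by
  have hae : ∀ᵐ x ∂(volume.restrict (Icc (0 : ℝ) 1)), x ∈ Ioc (0 : ℝ) 1 := by
    rw [← Measure.restrict_congr_set (Ioc_ae_eq_Icc (μ := volume) (a := (0 : ℝ)) (b := 1))]
    exact ae_restrict_mem measurableSet_Ioc
  have hcongr : ∫ q in S ×ˢ T, (adjKernel p G (vertexAt n q.1) (vertexAt n q.2) - K q.1 q.2)
      ∂((volume.restrict (Icc (0 : ℝ) 1)).prod (volume.restrict (Icc (0 : ℝ) 1))) =
      ∫ q in S ×ˢ T, (graphKernel p G q.1 q.2 - K q.1 q.2)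
      ∂((volume.restrict (Icc (0 : ℝ) 1)).prod (volume.restrict (Icc (0 : ℝ) 1))) := by
    refine integral_congr_ae (ae_restrict_of_ae ?_)
    filter_upwards [Measure.quasiMeasurePreserving_fst.ae hae,
      Measure.quasiMeasurePreserving_snd.ae hae] with q h1 h2
    rw [graphKernel_eq p G h1 h2]
  rw [hcongr, ← Measure.prod_restrict, Measure.restrict_restrict hS, Measure.restrict_restrict hT,
    Measure.prod_restrict, ← Measure.volume_eq_prod]
  refine abs_setIntegral_le_cutNorm (W := fun x y => graphKernel p G x y - K x y)
    (B := 1 / p + C) (fun x y => ?_)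
    (hS.inter measurableSet_Icc) (hT.inter measurableSet_Icc) inter_subset_right
    inter_subset_right
  exact (abs_sub _ _).trans (add_le_add (abs_graphKernel_le hp G x y) (hK x y))

theorem IsKernelBdd.boundedKernel {κ : ℝ → ℝ → ℝ} {C : ℝ} (h : IsKernelBdd κ C) :
    BoundedKernel κ C where
  measurable := h.1
  symm := h.2.1
  nonneg x y := (h.2.2 x y).1
  le x y := (h.2.2 x y).2

theorem tendsto_tDen_succ {p : ℕ → ℝ} {G : ∀ n, SimpleGraph (Fin n)} (hp : ∀ n, 0 < p n)
    (hbdd : ∀ (m : ℕ) (T : SimpleGraph (Fin m)), T.IsTree →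
      ∃ M : ℝ, ∀ᶠ n in atTop, tDen (p n) T (G n) ≤ M)
    {κ : ℝ → ℝ → ℝ} {C : ℝ} (hC : 0 ≤ C) (hκ : IsKernelBdd κ C)
    (hconv : Tendsto (fun n => cutDist (graphKernel (p n) (G n)) κ) atTop (nhds 0))
    {k : ℕ} {T : SimpleGraph (Fin k)} (hT : T.IsTree) :
    Tendsto (fun n => tDen (p (n + 1)) T (G (n + 1))) atTop (nhds (homDensity T κ)) := by
  set μ := volume.restrict (Icc (0 : ℝ) 1) with hμ
  choose τ hτ hcut using fun n : ℕ => exists_mpBij_cutNorm_lt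
    (graphKernel (p (n + 1)) (G (n + 1))) κ (Nat.one_div_pos_of_nat (α := ℝ) (n := n))
  let W : ℕ → ℝ → ℝ → ℝ := fun n x y =>
    adjKernel (p (n + 1)) (G (n + 1)) (vertexAt n x) (vertexAt n y)
  let K : ℕ → ℝ → ℝ → ℝ := fun n x y => κ (τ n x) (τ n y)
  have hA : ∀ n, BoundedKernel (adjKernel (p (n + 1)) (G (n + 1))) (1 / p (n + 1)) := fun n =>
    boundedKernel_adjKernel (hp _) _
  have hW : ∀ n, BoundedKernel (W n) (1 / p (n + 1)) := fun n =>
    (hA n).comp (measurable_vertexAt n)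
  have hκ' := hκ.boundedKernel
  have hK : ∀ n, BoundedKernel (K n) C := fun n => hκ'.comp (hτ n).1.measurable
  have hWeval : ∀ n (t : PlaneTree), ∫ x, t.eval μ (W n) x ∂μ =
      ∫ i, t.eval (vertexMeasure n) (adjKernel (p (n + 1)) (G (n + 1))) i ∂(vertexMeasure n) :=
    fun n t => t.integral_eval_comp (measurePreserving_vertexAt n) (hA n).measurable
  have hKeval : ∀ n (t : PlaneTree), ∫ x, t.eval μ (K n) x ∂μ = ∫ x, t.eval μ κ x ∂μ :=
    fun n t => t.integral_eval_comp (hτ n).1 hκ'.measurable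
  have hε : Tendsto (fun n : ℕ => cutDist (graphKernel (p (n + 1)) (G (n + 1))) κ +
      1 / ((n : ℝ) + 1)) atTop (nhds 0) := by
    have := ((tendsto_add_atTop_iff_nat 1).mpr hconv).add
      (tendsto_one_div_add_atTop_nhds_zero_nat (𝕜 := ℝ))
    rwa [add_zero] at this
  have hbdd' : ∀ t : PlaneTree, ∃ M, ∀ᶠ n in atTop, ∫ x, t.eval μ (W n) x ∂μ ≤ M := by
    intro t
    obtain ⟨m, S, hS, hd⟩ := t.exists_tree
    obtain ⟨M, hM⟩ := hbdd m S hS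
    refine ⟨M, ?_⟩
    filter_upwards [(tendsto_add_atTop_nat 1).eventually hM] with n hn
    rwa [hWeval, ← hd _ _ _ _ (hA n), decoratedDensity_adjKernel]
  obtain ⟨t, ht⟩ := exists_planeTree_decoratedDensity hT fun _ => .leaf
  have hmain := tendsto_integral_abs_eval_sub (μ := μ) hC hW hK hbdd' hε
    (fun n S T hS hT => (abs_setIntegral_adjKernel_sub_le (hp _) _
      (fun x y => by rw [abs_of_nonneg ((hK n).nonneg x y)]; exact (hK n).le x y)
      hS hT).trans (hcut n).le) t
  rw [homDensity_eq_decoratedDensity, ht _ _ _ _ hκ', ← hμ]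
  refine tendsto_iff_norm_sub_tendsto_zero.mpr
    (squeeze_zero (fun n => norm_nonneg _) (fun n => ?_) hmain)
  rw [← decoratedDensity_adjKernel, ht _ _ _ _ (hA n), ← hWeval, ← hKeval n t, ← integral_sub]
  · exact norm_integral_le_integral_norm _
  · exact ((hW n).boundedMeasurable_eval μ t).integrable μ
  · exact ((hK n).boundedMeasurable_eval μ t).integrable μ

end CutDistance

/-- Embedding lemma for trees: if `δ_□(G_n,κ) → 0` and tree counts are
bounded, then `s_p(T,G_n) → s(T,κ)` for every finite tree `T`. -/
theorem tree_embedding_lemma (p : ℕ → ℝ) (hp : ∀ n, p n ∈ Ioc (0:ℝ) 1)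
    (hpn : Tendsto (fun n : ℕ => (n:ℝ) * p n) atTop atTop)
    (C : ℝ) (hC : 0 < C) (G : ∀ n, SimpleGraph (Fin n))
    (htree : ∀ (m : ℕ) (T : SimpleGraph (Fin m)), T.IsTree →
      ∃ M : ℝ, ∀ n, sDen (p n) T (G n) ≤ M)
    (κ : ℝ → ℝ → ℝ) (hκ : IsKernelBdd κ C)
    (hconv : Tendsto (fun n => cutDist (graphKernel (p n) (G n)) κ) atTop (nhds 0)) :
    ∀ (k : ℕ) (T : SimpleGraph (Fin k)), T.IsTree →
      Tendsto (fun n => sDen (p n) T (G n)) atTop (nhds (homDensity T κ)) := by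
  have hp0 : ∀ n, 0 < p n := fun n => (hp n).1
  intro k T hT
  refine tendsto_sDen_of_tendsto_tDen hp0 hpn htree hT ((tendsto_add_atTop_iff_nat 1).mp ?_)
  exact tendsto_tDen_succ hp0 (fun m S hS => exists_eventually_tDen_le hp0 hpn htree hS) hC.le hκ
    hconv hT
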